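/- arXiv:2411.19859 — 9 statements merged into one kernel-verified Lean document; each statement's English description precedes it below -/
import Mathlib

section
/- There is a universal constant C > 0 with the following property. For every finite weighted undirected graph G = (V,E,ℓ) with n ≥ 2 vertices and every distance parameter D > 0, there exists a probability distribution over partitions of V such that (i) almost surely every part K of the partition has strong diameter at most D, and (ii) for every edge e = {v,w} ∈ E of length ℓ_e, the probability that v and w lie in different parts of the partition is at most C·ℓ_e·log n / D. (Existence form of the paper's Theorem on low-diameter decompositions of general graphs with strong diameter and quality O(log n).) -/
open SimpleGraph

section Defs

variable {V : Type} [Fintype V] [DecidableEq V]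

/-- Total length of a walk with respect to edge lengths `ℓ`. -/
def wlen {G : SimpleGraph V} (ℓ : Sym2 V → ℝ) {u v : V} (p : G.Walk u v) : ℝ :=
  (p.edges.map ℓ).sum

/-- All vertices of the walk lie in the vertex set `A`. -/
def WalkIn {G : SimpleGraph V} (A : Set V) {u v : V} (p : G.Walk u v) : Prop :=
  ∀ x ∈ p.support, x ∈ A

/-- The distance between `u` and `v` within the induced subgraph on `A`
is at most `r`: there is a walk of total length at most `r` that stays in `A`. -/
def DistLE (G : SimpleGraph V) (ℓ : Sym2 V → ℝ) (A : Set V) (u v : V) (r : ℝ) : Prop :=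
  ∃ p : G.Walk u v, WalkIn A p ∧ wlen ℓ p ≤ r

/-- Edge lengths are positive on all edges. -/
def PosWeights (G : SimpleGraph V) (ℓ : Sym2 V → ℝ) : Prop :=
  ∀ e ∈ G.edgeSet, 0 < ℓ e

end Defs

section Walks

variable {V : Type} {G : SimpleGraph V} {ℓ : Sym2 V → ℝ}

lemma wlen_append {u v w : V} (p : G.Walk u v) (q : G.Walk v w) :
    wlen ℓ (p.append q) = wlen ℓ p + wlen ℓ q := by
  simp [wlen]

lemma wlen_reverse {u v : V} (p : G.Walk u v) : wlen ℓ p.reverse = wlen ℓ p := by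
  simp [wlen]

lemma wlen_nonneg (hℓ : PosWeights G ℓ) {u v : V} (p : G.Walk u v) : 0 ≤ wlen ℓ p := by
  refine List.sum_nonneg fun x hx => ?_
  obtain ⟨e, he, rfl⟩ := List.mem_map.1 hx
  exact (hℓ e (p.edges_subset_edgeSet he)).le

lemma wlen_takeUntil_le [DecidableEq V] (hℓ : PosWeights G ℓ) {u v x : V} (p : G.Walk u v)
    (hx : x ∈ p.support) : wlen ℓ (p.takeUntil x hx) ≤ wlen ℓ p := by
  conv_rhs => rw [← p.take_spec hx, wlen_append]
  linarith [wlen_nonneg hℓ (p.dropUntil x hx)]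

lemma wlen_bypass_le [DecidableEq V] (hℓ : PosWeights G ℓ) {u v : V} (p : G.Walk u v) :
    wlen ℓ p.bypass ≤ wlen ℓ p := by
  refine List.Sublist.sum_le_sum (p.edges_bypass_sublist_edges.map ℓ) fun x hx => ?_
  obtain ⟨e, he, rfl⟩ := List.mem_map.1 hx
  exact (hℓ e (p.edges_subset_edgeSet he)).le

lemma finite_isPath [Fintype V] (u v : V) : {p : G.Walk u v | p.IsPath}.Finite := by
  have hinj : Function.Injective
      (fun p : {p : G.Walk u v | p.IsPath} =>
        (⟨p.1.support, p.2.support_nodup⟩ : {l : List V // l.Nodup})) := by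
    intro p q h
    exact Subtype.ext (Walk.ext_support (congrArg Subtype.val h))
  exact Set.finite_coe_iff.1 (Finite.of_injective _ hinj)

/-- Within a vertex set, a vertex that can be reached from `a` is reached by a shortest walk. -/
lemma exists_shortest_walk [Fintype V] [DecidableEq V] (hℓ : PosWeights G ℓ) (A : Set V) (a x : V)
    (h : ∃ p : G.Walk a x, WalkIn A p) :
    ∃ p : G.Walk a x, WalkIn A p ∧ ∀ q : G.Walk a x, WalkIn A q → wlen ℓ p ≤ wlen ℓ q := by
  have hin : ∀ q : G.Walk a x, WalkIn A q → WalkIn A q.bypass := fun q hq y hy =>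
    hq y (q.support_bypass_subset_support hy)
  obtain ⟨p₀, hp₀⟩ := h
  obtain ⟨p, hp, hmin⟩ := Set.exists_min_image {p : G.Walk a x | p.IsPath ∧ WalkIn A p} (wlen ℓ)
    ((finite_isPath a x).subset fun p hp => hp.1) ⟨p₀.bypass, p₀.bypass_isPath, hin p₀ hp₀⟩
  exact ⟨p, hp.2, fun q hq =>
    (hmin q.bypass ⟨q.bypass_isPath, hin q hq⟩).trans (wlen_bypass_le hℓ q)⟩

/-- The distance from `a` inside the subgraph induced on `A`, with `N` the set of vertices at finite
distance. -/
lemma exists_dist [Fintype V] [DecidableEq V] (hℓ : PosWeights G ℓ) (A : Set V) {a : V} (ha : a ∈ A) :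
    ∃ (N : Set V) (d : V → ℝ), N ⊆ A ∧ a ∈ N ∧ d a = 0 ∧ (∀ x ∈ N, 0 ≤ d x) ∧
      (∀ x ∈ N, ∃ p : G.Walk a x, wlen ℓ p = d x ∧ ∀ y ∈ p.support, y ∈ N ∧ d y ≤ d x) ∧
      (∀ x ∈ N, ∀ y ∈ A, G.Adj x y → y ∈ N ∧ d y ≤ d x + ℓ s(x, y)) := by
  have key := fun (x : V) => exists_shortest_walk hℓ A a x
  choose P hP hmin using key
  classical
  set N : Set V := {x | ∃ p : G.Walk a x, WalkIn A p} with hN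
  set d : V → ℝ := fun x => if h : ∃ p : G.Walk a x, WalkIn A p then wlen ℓ (P x h) else 0 with hd
  have hdle : ∀ (x : V) (p : G.Walk a x), WalkIn A p → x ∈ N ∧ d x ≤ wlen ℓ p := by
    intro x p hp
    have hx : ∃ p : G.Walk a x, WalkIn A p := ⟨p, hp⟩
    refine ⟨hx, ?_⟩
    simp only [hd, dif_pos hx]
    exact hmin x hx p hp
  have hwalk : ∀ x ∈ N, ∃ p : G.Walk a x, WalkIn A p ∧ wlen ℓ p = d x := by
    intro x hx
    have hx' : ∃ p : G.Walk a x, WalkIn A p := hx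
    exact ⟨P x hx', hP x hx', by simp only [hd, dif_pos hx']⟩
  have hd0 : ∀ x ∈ N, 0 ≤ d x := by
    intro x hx
    obtain ⟨p, -, hp⟩ := hwalk x hx
    exact hp ▸ wlen_nonneg hℓ p
  have hnil := hdle a Walk.nil (by intro y hy; simp at hy; exact hy ▸ ha)
  refine ⟨N, d, ?_, hnil.1, le_antisymm (by simpa [wlen] using hnil.2) (hd0 a hnil.1), hd0, ?_, ?_⟩
  · rintro x ⟨p, hp⟩
    exact hp x p.end_mem_support
  · intro x hx
    obtain ⟨p, hpA, hp⟩ := hwalk x hx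
    refine ⟨p, hp, fun y hy => ?_⟩
    have := hdle y (p.takeUntil y hy) fun z hz => hpA z (p.support_takeUntil_subset_support hy hz)
    exact ⟨this.1, this.2.trans ((wlen_takeUntil_le hℓ p hy).trans hp.le)⟩
  · intro x hx y hy hxy
    obtain ⟨p, hpA, hp⟩ := hwalk x hx
    have := hdle y (p.append (Walk.cons hxy Walk.nil)) (by
      intro z hz
      rw [Walk.mem_support_append_iff] at hz
      rcases hz with hz | hz
      · exact hpA z hz
      · simp only [Walk.support_cons, Walk.support_nil, List.mem_cons, List.not_mem_nil,
          or_false] at hz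
        rcases hz with rfl | rfl
        · exact hpA _ p.end_mem_support
        · exact hy)
    refine ⟨this.1, this.2.trans (le_of_eq ?_)⟩
    rw [wlen_append, hp]
    simp [wlen]

end Walks

section Distributions

/-- The law of a random superlevel set `{x | t ≤ g x}`, with `t` uniform in `(0, 1]`. -/
lemma exists_superlevel_law {V : Type} [Fintype V] [DecidableEq V] (g : V → ℝ)
    (h0 : ∀ x, 0 ≤ g x) (h1 : ∀ x, g x ≤ 1) :
    ∃ q : Finset V → ℝ, (∀ B, 0 ≤ q B) ∧ ∑ B, q B = 1 ∧
      (∀ B, q B ≠ 0 → ∃ t, 0 < t ∧ t ≤ 1 ∧ ∀ x, x ∈ B ↔ t ≤ g x) ∧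
      (∀ x, ∑ B, (if x ∈ B then q B else 0) = g x) := by
  set μ : MeasureTheory.Measure ℝ := MeasureTheory.volume.restrict (Set.Ioc 0 1) with hμ
  have : MeasureTheory.IsFiniteMeasure μ := ⟨by simp [hμ]⟩
  set F : ℝ → Finset V := fun t => Finset.univ.filter fun x => t ≤ g x with hF
  have hmeas : ∀ B : Finset V, MeasurableSet (F ⁻¹' {B}) := by
    intro B
    have : F ⁻¹' {B} = ⋂ x, {t | t ≤ g x ↔ x ∈ B} := by
      ext t
      simp [hF, Finset.ext_iff]
    rw [this]
    refine MeasurableSet.iInter fun x => ?_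
    by_cases hx : x ∈ B
    · simp only [hx, iff_true]
      exact measurableSet_Iic
    · simp only [hx, iff_false, not_le]
      exact measurableSet_Ioi
  have hsum : ∀ S : Finset (Finset V), ∑ B ∈ S, μ.real (F ⁻¹' {B}) = μ.real (F ⁻¹' S) :=
    fun S => MeasureTheory.sum_measureReal_preimage_singleton S fun B _ => hmeas B
  refine ⟨fun B => μ.real (F ⁻¹' {B}), fun B => MeasureTheory.measureReal_nonneg, ?_, ?_, ?_⟩
  · rw [hsum]
    simp [hμ, MeasureTheory.measureReal_def]
  · intro B hB
    have : (F ⁻¹' {B} ∩ Set.Ioc 0 1).Nonempty := by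
      by_contra hne
      rw [Set.not_nonempty_iff_eq_empty] at hne
      refine hB ?_
      dsimp only
      rw [MeasureTheory.measureReal_def, hμ, MeasureTheory.Measure.restrict_apply (hmeas B), hne]
      simp
    obtain ⟨t, ht, ht0, ht1⟩ := this
    refine ⟨t, ht0, ht1, fun x => ?_⟩
    rw [← Set.mem_singleton_iff.1 ht]
    simp [hF]
  · intro x
    rw [← Finset.sum_filter, hsum]
    have : F ⁻¹' ((Finset.univ.filter fun B : Finset V => x ∈ B : Finset (Finset V)) :
        Set (Finset V)) = Set.Iic (g x) := by
      ext t
      simp [hF]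
    rw [this, MeasureTheory.measureReal_def, hμ,
      MeasureTheory.Measure.restrict_apply measurableSet_Iic]
    have : Set.Iic (g x) ∩ Set.Ioc 0 1 = Set.Ioc 0 (g x) := by
      ext t
      simp only [Set.mem_inter_iff, Set.mem_Iic, Set.mem_Ioc]
      exact ⟨fun h => ⟨h.2.1, h.1⟩, fun h => ⟨h.2, h.1, h.2.trans (h1 x)⟩⟩
    rw [this, Real.volume_Ioc, sub_zero, ENNReal.toReal_ofReal (h0 x)]

/-- Sampling `i` from `q`, then `b` from `P i`, and applying `f i`. -/
lemma exists_bind_law {ι β γ : Type} [Fintype ι] [Fintype β] [Fintype γ] [DecidableEq γ]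
    (q : ι → ℝ) (P : ι → β → ℝ) (f : ι → β → γ) (hq : ∀ i, 0 ≤ q i)
    (hP : ∀ i, q i ≠ 0 → ∀ b, 0 ≤ P i b) :
    ∃ p : γ → ℝ, (∀ c, 0 ≤ p c) ∧
      (∀ φ : γ → ℝ, ∑ c, φ c * p c = ∑ i, q i * ∑ b, φ (f i b) * P i b) ∧
      (∀ c, p c ≠ 0 → ∃ i b, q i ≠ 0 ∧ P i b ≠ 0 ∧ f i b = c) := by
  refine ⟨fun c => ∑ i, ∑ b, if f i b = c then q i * P i b else 0, fun c => ?_, fun φ => ?_,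
    fun c hc => ?_⟩
  · refine Finset.sum_nonneg fun i _ => Finset.sum_nonneg fun b _ => ?_
    split_ifs
    · by_cases hi : q i = 0
      · simp [hi]
      · exact mul_nonneg (hq i) (hP i hi b)
    · exact le_rfl
  · simp only [Finset.mul_sum]
    rw [Finset.sum_comm]
    refine Finset.sum_congr rfl fun i _ => ?_
    rw [Finset.sum_comm]
    refine Finset.sum_congr rfl fun b _ => ?_
    simp only [mul_ite, mul_zero, Finset.sum_ite_eq, Finset.mem_univ, if_true]
    ring
  · obtain ⟨i, -, hi⟩ := Finset.exists_ne_zero_of_sum_ne_zero hc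
    obtain ⟨b, -, hb⟩ := Finset.exists_ne_zero_of_sum_ne_zero hi
    by_cases h : f i b = c
    · rw [if_pos h] at hb
      exact ⟨i, b, left_ne_zero_of_mul hb, right_ne_zero_of_mul hb, h⟩
    · simp [h] at hb

end Distributions

section Carving

variable {V : Type} [Fintype V] [DecidableEq V] {G : SimpleGraph V} {ℓ : Sym2 V → ℝ}

/-- The membership probabilities of a ball around `a` whose radius has the exponential
distribution of rate `β` truncated at `R`. -/
lemma exists_ball_profile (hℓ : PosWeights G ℓ) (A : Set V) {a : V} (ha : a ∈ A) {β R : ℝ}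
    (hβ : 0 < β) (hR : 0 < R) :
    ∃ g : V → ℝ, (∀ x, 0 ≤ g x) ∧ (∀ x, g x ≤ 1) ∧ g a = 1 ∧ (∀ x, 0 < g x → x ∈ A) ∧
      (∀ x, 0 < g x → ∃ p : G.Walk a x, wlen ℓ p ≤ R ∧ ∀ y ∈ p.support, g x ≤ g y) ∧
      (∀ v ∈ A, ∀ w ∈ A, G.Adj v w →
        g v - g w ≤ β * ℓ s(v, w) *
          (g v + Real.exp (-(β * R)) / (1 - Real.exp (-(β * R))))) := by
  classical
  obtain ⟨N, d, hNA, haN, hda, hd0, hwalk, hadj⟩ := exists_dist hℓ A ha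
  set η := Real.exp (-(β * R)) with hη
  have hη0 : 0 < η := Real.exp_pos _
  have hη1 : η < 1 := by
    rw [hη, Real.exp_lt_one_iff]
    nlinarith [mul_pos hβ hR]
  have h1η : 0 < 1 - η := by linarith
  set e : V → ℝ := fun x => if x ∈ N then max (Real.exp (-(β * d x))) η else η with he
  have heη : ∀ x, η ≤ e x := by
    intro x
    simp only [he]
    split_ifs
    · exact le_max_right _ _
    · exact le_rfl
  have he1 : ∀ x, e x ≤ 1 := by
    intro x
    simp only [he]
    split_ifs with h
    · refine max_le ?_ hη1.le
      rw [Real.exp_le_one_iff]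
      nlinarith [mul_nonneg hβ.le (hd0 x h)]
    · exact hη1.le
  have hpos : ∀ x, 0 < (e x - η) / (1 - η) → x ∈ N ∧ d x < R := by
    intro x hx
    have hx' : η < e x := by
      have := (div_pos_iff_of_pos_right h1η).1 hx
      linarith
    simp only [he] at hx'
    split_ifs at hx' with h
    · refine ⟨h, ?_⟩
      rcases lt_max_iff.1 hx' with h' | h'
      · rw [hη, Real.exp_lt_exp] at h'
        exact lt_of_mul_lt_mul_left (by linarith : β * d x < β * R) hβ.le
      · exact absurd h' (lt_irrefl _)
    · exact absurd hx' (lt_irrefl _)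
  refine ⟨fun x => (e x - η) / (1 - η), fun x => ?_, fun x => ?_, ?_, fun x hx => ?_,
    fun x hx => ?_, ?_⟩
  · exact div_nonneg (by linarith [heη x]) h1η.le
  · rw [div_le_one h1η]
    linarith [he1 x]
  · have : e a = 1 := by simp [he, haN, hda, hη1.le]
    simp only [this]
    exact div_self h1η.ne'
  · exact hNA (hpos x hx).1
  · obtain ⟨hxN, hxR⟩ := hpos x hx
    obtain ⟨p, hp, hsupp⟩ := hwalk x hxN
    refine ⟨p, by linarith, fun y hy => ?_⟩
    obtain ⟨hyN, hyd⟩ := hsupp y hy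
    have : e x ≤ e y := by
      simp only [he, if_pos hxN, if_pos hyN]
      gcongr
    exact div_le_div_of_nonneg_right (by linarith) h1η.le
  · intro v hv w hw hvw
    have hl : 0 < ℓ s(v, w) := hℓ _ hvw
    have hle : e v - e w ≤ β * ℓ s(v, w) * e v := by
      have hev : 0 ≤ e v := hη0.le.trans (heη v)
      by_cases hvN : v ∈ N
      · obtain ⟨hwN, hdw⟩ := hadj v hvN w hw hvw
        have h1 : 1 - β * ℓ s(v, w) ≤ Real.exp (-(β * ℓ s(v, w))) := by
          linarith [Real.add_one_le_exp (-(β * ℓ s(v, w)))]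
        have h2 : Real.exp (-(β * ℓ s(v, w))) * e v ≤ e w := by
          simp only [he, if_pos hvN, if_pos hwN]
          rw [mul_max_of_nonneg _ _ (Real.exp_pos _).le, ← Real.exp_add]
          refine max_le_max (Real.exp_le_exp.2 ?_) ?_
          · nlinarith
          · refine mul_le_of_le_one_left hη0.le (Real.exp_le_one_iff.2 ?_)
            nlinarith [mul_pos hβ hl]
        nlinarith
      · have : e v = η := by simp [he, hvN]
        have := heη w
        nlinarith [mul_nonneg (mul_pos hβ hl).le hev]
    have e1 : (e v - η) / (1 - η) - (e w - η) / (1 - η) = (e v - e w) / (1 - η) := by ring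
    have e2 : β * ℓ s(v, w) * ((e v - η) / (1 - η) + η / (1 - η)) =
        (β * ℓ s(v, w) * e v) / (1 - η) := by ring
    simp only [e1, e2]
    gcongr

/-- There is a random partition of the subgraph induced on `A` into clusters of strong diameter at
most `D`, where each edge is cut with probability at most `M` times its length. -/
def HasRandomPartition (G : SimpleGraph V) (ℓ : Sym2 V → ℝ) (D : ℝ) (A : Finset V) (M : ℝ) : Prop :=
  ∃ p : (V → V) → ℝ, (∀ c, 0 ≤ p c) ∧ ∑ c, p c = 1 ∧
    (∀ c, p c ≠ 0 → (∀ x ∈ A, c x ∈ A) ∧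
      ∀ u ∈ A, ∀ w ∈ A, c u = c w → DistLE G ℓ {x | x ∈ A ∧ c x = c u} u w D) ∧
    (∀ v ∈ A, ∀ w ∈ A, G.Adj v w → ∑ c, (if c v ≠ c w then p c else 0) ≤ M * ℓ s(v, w))

lemma HasRandomPartition.mono (hℓ : PosWeights G ℓ) {D M M' : ℝ} {A : Finset V}
    (h : HasRandomPartition G ℓ D A M) (hM : M ≤ M') : HasRandomPartition G ℓ D A M' := by
  obtain ⟨p, h0, h1, h2, h3⟩ := h
  exact ⟨p, h0, h1, h2, fun v hv w hw hvw => (h3 v hv w hw hvw).trans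
    (mul_le_mul_of_nonneg_right hM (hℓ _ hvw).le)⟩

/-- Carving a random ball around `a` out of `A` and partitioning the rest at random. -/
lemma HasRandomPartition.of_sdiff (hℓ : PosWeights G ℓ) {A : Finset V} {a : V} (ha : a ∈ A)
    {β D M : ℝ} (hβ : 0 < β) (hD : 0 < D) (hM : β ≤ M)
    (h : ∀ B : Finset V, a ∈ B → HasRandomPartition G ℓ D (A \ B) M) :
    HasRandomPartition G ℓ D A
      (M + β * (Real.exp (-(β * (D / 2))) / (1 - Real.exp (-(β * (D / 2)))))) := by
  set ε := Real.exp (-(β * (D / 2))) / (1 - Real.exp (-(β * (D / 2)))) with hε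
  obtain ⟨g, hg0, hg1, hga, hgA, hgwalk, hgadj⟩ :=
    exists_ball_profile hℓ (A : Set V) (Finset.mem_coe.2 ha) hβ (half_pos hD)
  obtain ⟨q, hq0, hq1, hqB, hqg⟩ := exists_superlevel_law g hg0 hg1
  unfold HasRandomPartition at h
  choose! P hP0 hP1 hPc hPcut using h
  have haB : ∀ B, q B ≠ 0 → a ∈ B := by
    intro B hB
    obtain ⟨t, ht0, ht1, hB⟩ := hqB B hB
    rw [hB, hga]
    exact ht1
  have hBA : ∀ B, q B ≠ 0 → ∀ x ∈ B, x ∈ A := by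
    intro B hB x hx
    obtain ⟨t, ht0, ht1, hB⟩ := hqB B hB
    exact hgA x (ht0.trans_le ((hB x).1 hx))
  have hwalk : ∀ B, q B ≠ 0 → ∀ x ∈ B,
      ∃ p : G.Walk a x, wlen ℓ p ≤ D / 2 ∧ ∀ y ∈ p.support, y ∈ B := by
    intro B hB x hx
    obtain ⟨t, ht0, ht1, hB⟩ := hqB B hB
    have hx' := (hB x).1 hx
    obtain ⟨p, hp, hy⟩ := hgwalk x (ht0.trans_le hx')
    exact ⟨p, hp, fun y hyp => (hB y).2 (hx'.trans (hy y hyp))⟩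
  obtain ⟨p, hp0, hpφ, hpc⟩ := exists_bind_law q P
    (fun B c x => if x ∈ B then a else c x) hq0 fun B hB => hP0 B (haB B hB)
  refine ⟨p, hp0, ?_, ?_, ?_⟩
  · have := hpφ fun _ => 1
    simp only [one_mul] at this
    rw [this, ← hq1]
    refine Finset.sum_congr rfl fun B _ => ?_
    by_cases hB : q B = 0
    · simp [hB]
    · rw [hP1 B (haB B hB), mul_one]
  · intro c' hc'
    obtain ⟨B, c, hB, hc, rfl⟩ := hpc c' hc'
    obtain ⟨hcmem, hcdist⟩ := hPc B (haB B hB) c hc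
    have hca : ∀ x ∈ A, x ∉ B → c x ≠ a := by
      intro x hx hxB hxa
      have := hcmem x (Finset.mem_sdiff.2 ⟨hx, hxB⟩)
      rw [hxa] at this
      exact (Finset.mem_sdiff.1 this).2 (haB B hB)
    refine ⟨fun x hx => ?_, fun u hu w hw huw => ?_⟩
    · dsimp only
      split_ifs with hxB
      · exact ha
      · exact (Finset.mem_sdiff.1 (hcmem x (Finset.mem_sdiff.2 ⟨hx, hxB⟩))).1
    · dsimp only at huw ⊢
      by_cases huB : u ∈ B
      · have hwB : w ∈ B := by
          by_contra hwB
          rw [if_pos huB, if_neg hwB] at huw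
          exact hca w hw hwB huw.symm
        obtain ⟨p₁, hp₁, hs₁⟩ := hwalk B hB u huB
        obtain ⟨p₂, hp₂, hs₂⟩ := hwalk B hB w hwB
        refine ⟨p₁.reverse.append p₂, fun y hy => ?_, ?_⟩
        · have hyB : y ∈ B := by
            rw [Walk.mem_support_append_iff, Walk.support_reverse, List.mem_reverse] at hy
            exact hy.elim (hs₁ y) (hs₂ y)
          simp [hyB, huB, hBA B hB y hyB]
        · rw [wlen_append, wlen_reverse]
          linarith
      · have hwB : w ∉ B := by
          intro hwB
          rw [if_neg huB, if_pos hwB] at huw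
          exact hca u hu huB huw
        rw [if_neg huB, if_neg hwB] at huw
        obtain ⟨r, hr, hrlen⟩ := hcdist u (Finset.mem_sdiff.2 ⟨hu, huB⟩) w
          (Finset.mem_sdiff.2 ⟨hw, hwB⟩) huw
        refine ⟨r, fun y hy => ?_, hrlen⟩
        obtain ⟨hyA, hyc⟩ := hr y hy
        obtain ⟨hyA, hyB⟩ := Finset.mem_sdiff.1 hyA
        simp [hyA, hyB, huB, hyc]
  · have hcut : ∀ v ∈ A, ∀ w ∈ A, G.Adj v w → g w ≤ g v →
        ∑ c, (if c v ≠ c w then p c else 0) ≤ (M + β * ε) * ℓ s(v, w) := by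
      intro v hv w hw hvw hgvw
      have hl : 0 < ℓ s(v, w) := hℓ _ hvw
      have hsum := hpφ fun c => if c v ≠ c w then 1 else 0
      simp only [ite_mul, one_mul, zero_mul] at hsum
      rw [hsum]
      have hterm : ∀ B, q B * (∑ c, if (if v ∈ B then a else c v) ≠ (if w ∈ B then a else c w)
            then P B c else 0) ≤
          ((if v ∈ B then q B else 0) - (if w ∈ B then q B else 0)) +
            (q B - (if v ∈ B then q B else 0)) * (M * ℓ s(v, w)) := by
        intro B
        by_cases hB : q B = 0
        · simp [hB]
        obtain ⟨t, -, -, hBt⟩ := hqB B hB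
        have hwv : w ∈ B → v ∈ B := fun h => (hBt v).2 (((hBt w).1 h).trans hgvw)
        by_cases hvB : v ∈ B
        · by_cases hwB : w ∈ B
          · simp [hvB, hwB]
          · have : (∑ c, if a ≠ c w then P B c else 0) ≤ 1 := by
              rw [← hP1 B (haB B hB)]
              refine Finset.sum_le_sum fun c _ => ?_
              split_ifs
              · exact le_rfl
              · exact hP0 B (haB B hB) c
            simp only [hvB, hwB, if_true, if_false, sub_zero, sub_self, zero_mul, add_zero]
            exact mul_le_of_le_one_right (hq0 B) this
        · have hwB : w ∉ B := fun h => hvB (hwv h)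
          simp only [hvB, hwB, if_false, sub_zero, zero_add]
          exact mul_le_mul_of_nonneg_left (hPcut B (haB B hB) v (Finset.mem_sdiff.2 ⟨hv, hvB⟩) w
            (Finset.mem_sdiff.2 ⟨hw, hwB⟩) hvw) (hq0 B)
      refine (Finset.sum_le_sum fun B _ => hterm B).trans ?_
      rw [Finset.sum_add_distrib, ← Finset.sum_mul, Finset.sum_sub_distrib,
        Finset.sum_sub_distrib, hq1, hqg, hqg]
      have h1 := hgadj v hv w hw hvw
      have h2 : β * ℓ s(v, w) * g v ≤ M * ℓ s(v, w) * g v :=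
        mul_le_mul_of_nonneg_right (mul_le_mul_of_nonneg_right hM hl.le) (hg0 v)
      linarith
    intro v hv w hw hvw
    rcases le_total (g w) (g v) with hle | hle
    · exact hcut v hv w hw hvw hle
    · have := hcut w hw v hv hvw.symm hle
      rw [Sym2.eq_swap] at this
      simpa only [ne_comm] using this

lemma hasRandomPartition (hℓ : PosWeights G ℓ) {β D : ℝ} (hβ : 0 < β) (hD : 0 < D)
    (A : Finset V) :
    HasRandomPartition G ℓ D A (β + A.card *
      (β * (Real.exp (-(β * (D / 2))) / (1 - Real.exp (-(β * (D / 2))))))) := by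
  set ε := Real.exp (-(β * (D / 2))) / (1 - Real.exp (-(β * (D / 2)))) with hε
  have hε0 : 0 ≤ ε := by
    refine div_nonneg (Real.exp_pos _).le (sub_nonneg.2 (Real.exp_le_one_iff.2 ?_))
    nlinarith [mul_pos hβ hD]
  have hβε : 0 ≤ β * ε := mul_nonneg hβ.le hε0
  induction A using Finset.strongInduction with
  | H A ih =>
    rcases A.eq_empty_or_nonempty with rfl | ⟨a, ha⟩
    · refine ⟨fun c => if c = id then 1 else 0, fun c => ?_, ?_, ?_, ?_⟩
      · dsimp only
        split_ifs <;> norm_num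
      · simp
      · simp
      · simp
    · have hcard : 1 ≤ A.card := Finset.card_pos.2 ⟨a, ha⟩
      have hcard' : (1 : ℝ) ≤ A.card := by exact_mod_cast hcard
      have := HasRandomPartition.of_sdiff (M := β + (A.card - 1 : ℝ) * (β * ε)) hℓ ha hβ hD
        (by nlinarith) fun B hB => by
          have hss : A \ B ⊂ A := by
            refine ⟨Finset.sdiff_subset, fun h => ?_⟩
            exact (Finset.mem_sdiff.1 (h ha)).2 hB
          refine (ih _ hss).mono hℓ ?_
          have : ((A \ B).card : ℝ) + 1 ≤ A.card := by exact_mod_cast Finset.card_lt_card hss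
          have : ((A \ B).card : ℝ) ≤ A.card - 1 := by linarith
          gcongr
      refine this.mono hℓ (le_of_eq ?_)
      rw [← hε]
      ring

end Carving

/-- **Low-diameter decompositions for general graphs (existence form).**
There is a universal constant `C > 0` such that for every finite weighted
undirected graph `G = (V,E,ℓ)` with `n ≥ 2` vertices and every `D > 0` there is
a probability distribution over partitions of `V` (a partition is encoded by a
map `c : V → V`, its parts being the fibers of `c`) such that almost surely
every part has strong diameter at most `D`, and every edge `{v,w}` of length
`ℓ s(v,w)` is cut (its endpoints lie in different parts) with probability at
most `C · ℓ s(v,w) · log n / D`. -/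
theorem ldd_general_graphs :
    ∃ C : ℝ, 0 < C ∧
      ∀ (V : Type) [Fintype V] [DecidableEq V],
      ∀ (G : SimpleGraph V) (ℓ : Sym2 V → ℝ),
        PosWeights G ℓ →
        2 ≤ Fintype.card V →
        ∀ D : ℝ, 0 < D →
          ∃ p : (V → V) → ℝ,
            (∀ c, 0 ≤ p c) ∧
            (∑ c, p c) = 1 ∧
            (∀ c, p c ≠ 0 → ∀ u w : V, c u = c w →
              DistLE G ℓ {x | c x = c u} u w D) ∧
            (∀ v w : V, G.Adj v w →
              (∑ c : V → V, if c v ≠ c w then p c else 0) ≤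
                C * ℓ s(v, w) * Real.log (Fintype.card V) / D) := by
  refine ⟨6, by norm_num, ?_⟩
  intro V _ _ G ℓ hℓ hn D hD
  set n : ℝ := (Fintype.card V : ℝ) with hn_def
  have hn2 : (2 : ℝ) ≤ n := by
    rw [hn_def]
    exact_mod_cast hn
  have hlog : 0 < Real.log n := Real.log_pos (by linarith)
  set β : ℝ := 2 * Real.log n / D with hβ_def
  have hβ : 0 < β := by positivity
  have hexp : Real.exp (-(β * (D / 2))) = n⁻¹ := by
    have : β * (D / 2) = Real.log n := by
      rw [hβ_def]
      field_simp
    rw [this, Real.exp_neg, Real.exp_log (by linarith)]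
  have hε : n * (n⁻¹ / (1 - n⁻¹)) ≤ 2 := by
    have h1 : n⁻¹ ≤ 2⁻¹ := inv_anti₀ (by norm_num) hn2
    rw [← mul_div_assoc, mul_inv_cancel₀ (by linarith), div_le_iff₀ (by linarith)]
    linarith
  have key := hasRandomPartition hℓ hβ hD (Finset.univ : Finset V)
  rw [hexp, Finset.card_univ] at key
  obtain ⟨p, h0, h1, h2, h3⟩ := key.mono hℓ (M' := 3 * β) (by nlinarith)
  refine ⟨p, h0, h1, fun c hc u w huw => ?_, fun v w hvw => ?_⟩
  · simpa using (h2 c hc).2 u (Finset.mem_univ u) w (Finset.mem_univ w) huw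
  · refine (h3 v (Finset.mem_univ v) w (Finset.mem_univ w) hvw).trans (le_of_eq ?_)
    rw [hβ_def]
    ring
end

section
/- There is a universal constant C > 0 with the following property. Let G = (V,E,ℓ) be a finite weighted graph, let D > 0, let τ ≥ 2, and let X ⊆ V be a set of centers such that every vertex v ∈ V has at least one x ∈ X with d_G(v,x) ≤ D (covering property) and at most τ centers x' ∈ X with d_G(v,x') ≤ 6D (packing property). Then there exists a probability distribution over collections of pairwise disjoint vertex sets (clusters) of G such that: (1) almost surely each cluster has strong diameter at most 8D; (2) for every edge e = {v,w} of length ℓ_e, the probability that at least one endpoint lies in some cluster while v and w do not lie in a common cluster is at most C·ℓ_e·log τ / D; and (3) every vertex lies in some cluster with probability at least 1/2. (Existence form of the paper's Generic Clustering Theorem.) -/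
open SimpleGraph

namespace GenericClustering

section Graph

variable {V : Type} {G : SimpleGraph V} {ℓ : Sym2 V → ℝ}

lemma wlen_append {u v w : V} (p : G.Walk u v) (q : G.Walk v w) :
    wlen ℓ (p.append q) = wlen ℓ p + wlen ℓ q := by
  simp [wlen, Walk.edges_append]

lemma wlen_reverse {u v : V} (p : G.Walk u v) : wlen ℓ p.reverse = wlen ℓ p := by
  simp [wlen, Walk.edges_reverse, List.map_reverse, List.sum_reverse]

lemma wlen_cons {u v w : V} (h : G.Adj u v) (p : G.Walk v w) :
    wlen ℓ (Walk.cons h p) = ℓ s(u, v) + wlen ℓ p := by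
  simp [wlen]

lemma wlen_bypass_le [DecidableEq V] (hℓ : PosWeights G ℓ) {u v : V} (p : G.Walk u v) :
    wlen ℓ p.bypass ≤ wlen ℓ p := by
  refine List.Sublist.sum_le_sum (p.edges_bypass_sublist_edges.map ℓ) ?_
  intro a ha
  obtain ⟨e, he, rfl⟩ := List.mem_map.1 ha
  exact (hℓ e (p.edges_subset_edgeSet he)).le

lemma exists_shortest_walk [Fintype V] (hℓ : PosWeights G ℓ) {u v : V} (h : G.Reachable u v) :
    ∃ p : G.Walk u v, ∀ q : G.Walk u v, wlen ℓ p ≤ wlen ℓ q := by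
  classical
  obtain ⟨p₀⟩ := h
  have : Nonempty (G.Path u v) := ⟨p₀.toPath⟩
  obtain ⟨p, hp⟩ := Finite.exists_min (fun p : G.Path u v => wlen ℓ p.1)
  exact ⟨p.1, fun q => (hp q.toPath).trans (wlen_bypass_le hℓ q)⟩

/-- A real-valued version of the graph distance, in which unreachable pairs are at an arbitrary
far distance `B`. -/
lemma exists_distance [Fintype V] (hℓ : PosWeights G ℓ) (B : ℝ) :
    ∃ d : V → V → ℝ,
      (∀ v w x, G.Adj v w → d v x ≤ d w x + ℓ s(v, w)) ∧
      (∀ v x r, DistLE G ℓ Set.univ v x r → d v x ≤ r) ∧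
      (∀ v x, d v x < B → ∃ p : G.Walk v x, wlen ℓ p = d v x) := by
  classical
  choose p hp using fun (u v : V) (h : G.Reachable u v) => exists_shortest_walk hℓ h
  refine ⟨fun v x => if h : G.Reachable v x then wlen ℓ (p v x h) else B, ?_, ?_, ?_⟩
  · intro v w x hvw
    by_cases h : G.Reachable w x
    · have h' : G.Reachable v x := hvw.reachable.trans h
      have := hp v x h' (Walk.cons hvw (p w x h))
      rw [wlen_cons] at this
      simp only [h, h', dif_pos]
      linarith
    · have h' : ¬ G.Reachable v x := fun h' => h (hvw.symm.reachable.trans h')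
      have := hℓ s(v, w) hvw
      simp only [h, h', dif_neg, not_false_eq_true]
      linarith
  · rintro v x r ⟨q, -, hq⟩
    have h : G.Reachable v x := ⟨q⟩
    simp only [h, dif_pos]
    exact (hp v x h q).trans hq
  · intro v x hlt
    by_cases h : G.Reachable v x
    · exact ⟨p v x h, by simp [h]⟩
    · simp [h] at hlt

lemma le_add_wlen {φ : V → ℝ} (hφ : ∀ v w, G.Adj v w → φ v ≤ φ w + ℓ s(v, w)) {u v : V}
    (p : G.Walk u v) : φ u ≤ φ v + wlen ℓ p := by
  induction p with
  | nil => simp [wlen]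
  | cons h p ih =>
    rw [wlen_cons]
    linarith [hφ _ _ h]

end Graph

section Winner

variable {V : Type}

/-- `i` maximizes `f` over `X`, with ties broken in favour of larger values of `e`. -/
def IsWinner (X : Finset V) (e : V → ℕ) (f : V → ℝ) (i : V) : Prop :=
  i ∈ X ∧ ∀ j ∈ X, j ≠ i → f j < f i ∨ (f j = f i ∧ e j < e i)

variable {X : Finset V} {e : V → ℕ} {f g : V → ℝ} {i j : V}

lemma exists_isWinner (hX : X.Nonempty) (he : Function.Injective e) (f : V → ℝ) :
    ∃ i, IsWinner X e f i := by
  obtain ⟨i, hi, h⟩ := X.exists_max_image (fun j => toLex (f j, e j)) hX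
  refine ⟨i, hi, fun j hj hji => ?_⟩
  rcases Prod.Lex.toLex_le_toLex.1 (h j hj) with h | ⟨h, h'⟩
  · exact Or.inl h
  · exact Or.inr ⟨h, lt_of_le_of_ne h' fun h => hji (he h)⟩

lemma IsWinner.eq (hi : IsWinner X e f i) (hj : IsWinner X e f j) : i = j := by
  by_contra hne
  rcases hi.2 j hj.1 (Ne.symm hne) with h | h <;> rcases hj.2 i hi.1 hne with h' | h' <;>
    linarith

lemma IsWinner.le (hi : IsWinner X e f i) (hj : j ∈ X) : f j ≤ f i := by
  by_cases hji : j = i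
  · rw [hji]
  · rcases hi.2 j hj hji with h | h
    exacts [h.le, h.1.le]

lemma IsWinner.of_le_add {t : ℝ} (hi : IsWinner X e f i)
    (h : ∀ j ∈ X, j ≠ i → g j ≤ f j + t) (h' : f i + t ≤ g i) : IsWinner X e g i := by
  refine ⟨hi.1, fun j hj hji => ?_⟩
  have := h j hj hji
  rcases hi.2 j hj hji with h₁ | ⟨h₁, h₂⟩
  · exact Or.inl (by linarith)
  · rcases lt_or_ge (g j) (g i) with h₃ | h₃
    · exact Or.inl h₃
    · exact Or.inr ⟨by linarith, h₂⟩

end Winner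

section Product

variable {V β : Type} [Fintype V] [DecidableEq V] (q : β → ℝ)

lemma prod_update_mul (δ : V → β) (i : V) (k : β) :
    (∏ j, q (Function.update δ i k j)) * q (δ i) = (∏ j, q (δ j)) * q k := by
  have h : (fun j => q (Function.update δ i k j)) = Function.update (fun j => q (δ j)) i (q k) := by
    ext j
    by_cases hj : j = i
    · subst hj; simp
    · simp [hj]
  rw [h, Finset.prod_update_of_mem (Finset.mem_univ i),
    ← Finset.mul_prod_erase Finset.univ (fun j => q (δ j)) (Finset.mem_univ i),
    Finset.sdiff_singleton_eq_erase]
  ring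

variable [Fintype β]

lemma sum_prod_eq_one (hq : ∑ k, q k = 1) : ∑ δ : V → β, ∏ j, q (δ j) = 1 := by
  classical
  have := Finset.prod_univ_sum (fun _ : V => (Finset.univ : Finset β)) (fun _ k => q k)
  simpa [hq] using this.symm

/-- Resampling one coordinate does not change a product expectation. -/
lemma sum_resample (hq : ∑ k, q k = 1) (i : V) (F : (V → β) → ℝ) :
    ∑ δ : V → β, (∏ j, q (δ j)) * ∑ k, q k * F (Function.update δ i k) =
      ∑ δ : V → β, (∏ j, q (δ j)) * F δ := by
  have h : ∑ z : (V → β) × β, (∏ j, q (z.1 j)) * (q z.2 * F (Function.update z.1 i z.2)) =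
      ∑ z : (V → β) × β, (∏ j, q (z.1 j)) * (q z.2 * F z.1) := by
    refine Finset.sum_nbij' (fun z => (Function.update z.1 i z.2, z.1 i))
      (fun z => (Function.update z.1 i z.2, z.1 i)) (by simp) (by simp) (by simp) (by simp) ?_
    rintro ⟨δ, k⟩ -
    simp only
    rw [← mul_assoc, ← mul_assoc, prod_update_mul]
  rw [Fintype.sum_prod_type, Fintype.sum_prod_type] at h
  simp only [← Finset.mul_sum, ← Finset.sum_mul, hq, one_mul] at h
  exact h

lemma sum_prod_le_of_coordinate (hq0 : ∀ k, 0 ≤ q k) (hq : ∑ k, q k = 1) (i : V)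
    (F H : (V → β) → ℝ) (K r : ℝ)
    (h : ∀ δ : V → β, ∑ k, q k * F (Function.update δ i k) ≤
      K * (∑ k, q k * H (Function.update δ i k) + r)) :
    ∑ δ : V → β, (∏ j, q (δ j)) * F δ ≤ K * (∑ δ : V → β, (∏ j, q (δ j)) * H δ + r) := by
  rw [← sum_resample q hq i F, ← sum_resample q hq i H]
  calc _ ≤ ∑ δ : V → β, (∏ j, q (δ j)) * (K * (∑ k, q k * H (Function.update δ i k) + r)) :=
        Finset.sum_le_sum fun δ _ =>
          mul_le_mul_of_nonneg_left (h δ) (Finset.prod_nonneg fun j _ => hq0 _)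
    _ = K * (∑ δ : V → β, (∏ j, q (δ j)) * ∑ k, q k * H (Function.update δ i k) +
          (∑ δ : V → β, ∏ j, q (δ j)) * r) := by
        rw [Finset.sum_mul, ← Finset.sum_add_distrib, Finset.mul_sum]
        exact Finset.sum_congr rfl fun δ _ => by ring
    _ = _ := by rw [sum_prod_eq_one q hq, one_mul]

end Product

section Geometric

variable {N : ℕ} {a : ℝ}

/-- The geometric distribution with ratio `a` conditioned on being less than `N`. -/
noncomputable def truncGeom (N : ℕ) (a : ℝ) (k : Fin N) : ℝ := (1 - a) * a ^ (k : ℕ) / (1 - a ^ N)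

lemma truncGeom_nonneg (ha0 : 0 ≤ a) (ha1 : a ≤ 1) (k : Fin N) : 0 ≤ truncGeom N a k :=
  div_nonneg (mul_nonneg (by linarith) (pow_nonneg ha0 _))
    (by linarith [pow_le_one₀ ha0 ha1 (n := N)])

lemma sum_truncGeom (haN : a ^ N ≠ 1) : ∑ k, truncGeom N a k = 1 := by
  have h : (1 - a) * ∑ k ∈ Finset.range N, a ^ k = 1 - a ^ N := by
    have := geom_sum_mul a N
    linarith
  simp only [truncGeom, ← Finset.sum_div, ← Finset.mul_sum]
  rw [Fin.sum_univ_eq_sum_range (fun k => a ^ k), h, div_self (sub_ne_zero.2 haN.symm)]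

lemma truncGeom_eq_tail (k : Fin N) :
    truncGeom N a k =
      (1 - a) * (∑ k' ∈ Finset.Ici k, truncGeom N a k' + a ^ N / (1 - a ^ N)) := by
  have h : (1 - a) * ∑ k' ∈ Finset.Ici k, a ^ (k' : ℕ) = a ^ (k : ℕ) - a ^ N := by
    have h₁ : ∑ k' ∈ Finset.Ici k, a ^ (k' : ℕ) = ∑ n ∈ Finset.Ico (k : ℕ) N, a ^ n := by
      rw [← Fin.map_valEmbedding_Ici, Finset.sum_map]
      rfl
    have := geom_sum_Ico_mul a k.2.le
    rw [h₁]
    linarith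
  simp only [truncGeom, ← Finset.sum_div, ← Finset.mul_sum]
  rw [h]
  ring

lemma sum_truncGeom_le (ha0 : 0 ≤ a) (ha1 : a ≤ 1) {S U : Finset (Fin N)}
    (hSU : ∀ k ∈ S, ∀ k', k ≤ k' → k' ∈ U) {m : ℝ} (hm : (S.card : ℝ) ≤ m) :
    ∑ k ∈ S, truncGeom N a k ≤
      m * (1 - a) * (∑ k ∈ U, truncGeom N a k + a ^ N / (1 - a ^ N)) := by
  have hU : 0 ≤ (1 - a) * (∑ k ∈ U, truncGeom N a k + a ^ N / (1 - a ^ N)) :=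
    mul_nonneg (by linarith) (add_nonneg (Finset.sum_nonneg fun k _ => truncGeom_nonneg ha0 ha1 k)
      (div_nonneg (pow_nonneg ha0 _) (by linarith [pow_le_one₀ ha0 ha1 (n := N)])))
  calc ∑ k ∈ S, truncGeom N a k
      ≤ ∑ k ∈ S, (1 - a) * (∑ k ∈ U, truncGeom N a k + a ^ N / (1 - a ^ N)) := by
        refine Finset.sum_le_sum fun k hk => ?_
        rw [truncGeom_eq_tail k]
        refine mul_le_mul_of_nonneg_left (add_le_add_left ?_ _) (by linarith)
        exact Finset.sum_le_sum_of_subset_of_nonneg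
          (fun k' hk' => hSU k hk k' (Finset.mem_Ici.1 hk')) fun k _ _ => truncGeom_nonneg ha0 ha1 k
    _ ≤ _ := by
        rw [Finset.sum_const, nsmul_eq_mul, mul_assoc]
        exact mul_le_mul_of_nonneg_right hm hU

lemma card_le_of_spread {S : Finset (Fin N)} {h t : ℝ} (hh : 0 < h) (ht : 0 ≤ t)
    (hS : ∀ k ∈ S, ∀ k' ∈ S, ((k : ℕ) : ℝ) * h ≤ ((k' : ℕ) : ℝ) * h + t) :
    (S.card : ℝ) ≤ t / h + 1 := by
  rcases S.eq_empty_or_nonempty with rfl | hne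
  · simp; positivity
  set k₀ := S.min' hne
  have hsub : S.map Fin.valEmbedding ⊆ Finset.Icc (k₀ : ℕ) (k₀ + ⌊t / h⌋₊) := by
    intro n hn
    obtain ⟨k, hk, rfl⟩ := Finset.mem_map.1 hn
    have hle : k₀ ≤ k := S.min'_le k hk
    have hle' : (k₀ : ℕ) ≤ k := hle
    have := hS k hk k₀ (S.min'_mem hne)
    have h₂ : ((k - k₀ : ℕ) : ℝ) ≤ t / h := by
      rw [le_div_iff₀ hh, Nat.cast_sub hle']
      linarith
    have := Nat.le_floor h₂
    simp only [Fin.valEmbedding_apply, Finset.mem_Icc]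
    omega
  have := Finset.card_le_card hsub
  rw [Finset.card_map, Nat.card_Icc] at this
  have h₃ : S.card ≤ ⌊t / h⌋₊ + 1 := by omega
  calc (S.card : ℝ) ≤ ⌊t / h⌋₊ + 1 := by exact_mod_cast h₃
    _ ≤ t / h + 1 := by
      have := Nat.floor_le (div_nonneg ht hh.le)
      linarith

end Geometric

section Cut

variable {V : Type}

/-- The score of a center `j` at `v` under the shifts `δ`, measured in units of `h`. -/
def score {N : ℕ} (h : ℝ) (d : V → V → ℝ) (δ : V → Fin N) (v j : V) : ℝ :=
  ((δ j : ℕ) : ℝ) * h - d v j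

lemma score_update_of_ne [DecidableEq V] {N : ℕ} {h : ℝ} {d : V → V → ℝ} {δ : V → Fin N} {v i j : V} {k : Fin N}
    (hji : j ≠ i) : score h d (Function.update δ i k) v j = score h d δ v j := by
  simp [score, hji]

variable [Fintype V] [DecidableEq V] {N : ℕ} {a h : ℝ} {d : V → V → ℝ} {X : Finset V} {e : V → ℕ}
  {win : (V → Fin N) → V → V}

lemma prob_win_and_cut_le (ha0 : 0 ≤ a) (ha1 : a ≤ 1) (haN : a ^ N ≠ 1) (hh : 0 < h)
    (hwin : ∀ δ v, IsWinner X e (score h d δ v) (win δ v)) {v w : V} {t : ℝ} (ht : 0 ≤ t)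
    (hvw : ∀ x, d v x ≤ d w x + t) (hwv : ∀ x, d w x ≤ d v x + t) (i : V) :
    ∑ δ : V → Fin N, (∏ j, truncGeom N a (δ j)) * (if win δ v = i ∧ win δ w ≠ i then 1 else 0) ≤
      (2 * t / h + 1) * (1 - a) *
        (∑ δ : V → Fin N, (∏ j, truncGeom N a (δ j)) * (if win δ v = i then 1 else 0) +
          a ^ N / (1 - a ^ N)) := by
  refine sum_prod_le_of_coordinate _ (truncGeom_nonneg ha0 ha1) (sum_truncGeom haN) i _ _ _ _ ?_
  intro δ
  simp only [mul_ite, mul_one, mul_zero, ← Finset.sum_filter]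
  refine sum_truncGeom_le ha0 ha1 ?_ (card_le_of_spread hh (by linarith) ?_)
  · intro k hk k' hkk'
    simp only [Finset.mem_filter, Finset.mem_univ, true_and] at hk ⊢
    have hk₁ := hwin (Function.update δ i k) v
    rw [hk.1] at hk₁
    refine (hwin _ v).eq (hk₁.of_le_add (t := 0) ?_ ?_)
    · intro j _ hji
      rw [score_update_of_ne hji, score_update_of_ne hji, add_zero]
    · have : ((k : ℕ) : ℝ) ≤ ((k' : ℕ) : ℝ) := by exact_mod_cast hkk'
      simp only [score, Function.update_self, add_zero]
      linarith [mul_le_mul_of_nonneg_right this hh.le]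
  · intro k hk k' hk'
    simp only [Finset.mem_filter, Finset.mem_univ, true_and] at hk hk'
    have hiw := hwin (Function.update δ i k) v
    rw [hk.1] at hiw
    have hjw := hwin (Function.update δ i k) w
    have h₁ := hjw.le hiw.1
    have hiw' := hwin (Function.update δ i k') v
    rw [hk'.1] at hiw'
    have h₂ := hiw'.le hjw.1
    rw [score_update_of_ne hk.2] at h₁ h₂
    simp only [score, Function.update_self] at h₁ h₂
    linarith [hvw (win (Function.update δ i k) w), hwv i]

lemma prob_cut_le (ha0 : 0 ≤ a) (ha1 : a ≤ 1) (haN : a ^ N ≠ 1) (hh : 0 < h)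
    (hwin : ∀ δ v, IsWinner X e (score h d δ v) (win δ v)) {v w : V} {t : ℝ} (ht : 0 ≤ t)
    (hvw : ∀ x, d v x ≤ d w x + t) (hwv : ∀ x, d w x ≤ d v x + t) {R : Finset V}
    (hR : ∀ δ, win δ v ∈ R) :
    ∑ δ : V → Fin N, (∏ j, truncGeom N a (δ j)) * (if win δ v ≠ win δ w then 1 else 0) ≤
      (2 * t / h + 1) * (1 - a) * (1 + R.card * (a ^ N / (1 - a ^ N))) := by
  have h₁ : ∀ δ : V → Fin N, (if win δ v ≠ win δ w then (1 : ℝ) else 0) =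
      ∑ i ∈ R, if win δ v = i ∧ win δ w ≠ i then 1 else 0 := by
    intro δ
    rw [Finset.sum_eq_single_of_mem (win δ v) (hR δ) fun i _ hi => if_neg fun h => hi h.1.symm]
    simp [eq_comm]
  have h₂ : ∀ δ : V → Fin N, ∑ i ∈ R, (if win δ v = i then (1 : ℝ) else 0) = 1 := by
    intro δ
    simp [hR δ]
  simp only [h₁, Finset.mul_sum]
  rw [Finset.sum_comm]
  refine (Finset.sum_le_sum fun i _ =>
    prob_win_and_cut_le ha0 ha1 haN hh hwin ht hvw hwv i).trans_eq ?_
  rw [← Finset.mul_sum, Finset.sum_add_distrib, Finset.sum_comm]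
  simp only [← Finset.mul_sum, h₂, mul_one, Finset.sum_const, nsmul_eq_mul]
  rw [sum_prod_eq_one _ (sum_truncGeom haN)]

end Cut

section Cluster

variable {V : Type} {G : SimpleGraph V} {ℓ : Sym2 V → ℝ} {N : ℕ} {h B : ℝ} {d : V → V → ℝ}
  {X : Finset V} {e : V → ℕ} {δ : V → Fin N} {win : V → V}

lemma walkIn_cluster [DecidableEq V]
    (hd : ∀ v w x, G.Adj v w → d v x ≤ d w x + ℓ s(v, w))
    (hd' : ∀ v x r, DistLE G ℓ Set.univ v x r → d v x ≤ r)
    (hwin : ∀ v, IsWinner X e (score h d δ v) (win v)) {v i : V} (hi : win v = i)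
    {p : G.Walk v i} (hp : wlen ℓ p = d v i) : WalkIn {x | win x = i} p := by
  intro y hy
  have hlen : wlen ℓ (p.takeUntil y hy) + wlen ℓ (p.dropUntil y hy) = d v i := by
    rw [← wlen_append, Walk.take_spec, hp]
  have hy' := hd' y i _ ⟨p.dropUntil y hy, fun _ _ => Set.mem_univ _, le_rfl⟩
  have hv := hwin v
  rw [hi] at hv
  refine (hwin y).eq (hv.of_le_add (t := wlen ℓ (p.takeUntil y hy)) ?_ ?_)
  · intro j _ _
    have := le_add_wlen (φ := fun u => d u j) (fun u w => hd u w j) (p.takeUntil y hy)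
    simp only [score]
    linarith
  · simp only [score]
    linarith

lemma distLE_cluster [DecidableEq V]
    (hd : ∀ v w x, G.Adj v w → d v x ≤ d w x + ℓ s(v, w))
    (hd' : ∀ v x r, DistLE G ℓ Set.univ v x r → d v x ≤ r)
    (hdB : ∀ v x, d v x < B → ∃ p : G.Walk v x, wlen ℓ p = d v x)
    (hwin : ∀ v, IsWinner X e (score h d δ v) (win v)) {r : ℝ} (hr : ∀ v, d v (win v) ≤ r)
    (hrB : r < B) {u w i : V} (hu : win u = i) (hw : win w = i) :
    DistLE G ℓ {x | win x = i} u w (2 * r) := by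
  have hur := hr u
  have hwr := hr w
  rw [hu] at hur
  rw [hw] at hwr
  obtain ⟨p, hp⟩ := hdB u i (by linarith)
  obtain ⟨q, hq⟩ := hdB w i (by linarith)
  refine ⟨p.append q.reverse, ?_, ?_⟩
  · intro y hy
    rw [Walk.mem_support_append_iff, Walk.support_reverse, List.mem_reverse] at hy
    rcases hy with hy | hy
    · exact walkIn_cluster hd hd' hwin hu hp y hy
    · exact walkIn_cluster hd hd' hwin hw hq y hy
  · rw [wlen_append, wlen_reverse]
    linarith

end Cluster

lemma sum_pushforward {Ω Γ : Type} [Fintype Ω] [Fintype Γ] [DecidableEq Γ] (W : Ω → ℝ)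
    (g : Ω → Γ) (P : Γ → Prop) [DecidablePred P] :
    ∑ c, (if P c then ∑ ω, (if g ω = c then W ω else 0) else 0) =
      ∑ ω, W ω * (if P (g ω) then 1 else 0) := by
  have h : ∀ c, (if P c then ∑ ω, (if g ω = c then W ω else 0) else 0) =
      ∑ ω, if g ω = c then W ω * (if P c then 1 else 0) else 0 := by
    intro c
    split_ifs <;> simp
  simp only [h]
  rw [Finset.sum_comm]
  simp

lemma exists_resolution {V : Type} [Fintype V] {G : SimpleGraph V} {ℓ : Sym2 V → ℝ}
    (hℓ : PosWeights G ℓ) (D L : ℝ) :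
    ∃ N : ℕ, 0 < N ∧ L ≤ N ∧ ∀ v w, G.Adj v w → 3 * D / N ≤ ℓ s(v, w) := by
  have h : ∀ᶠ N : ℕ in Filter.atTop, ∀ v w, G.Adj v w → 3 * D / ℓ s(v, w) ≤ N := by
    simp only [Filter.eventually_all]
    intro v w _
    exact tendsto_natCast_atTop_atTop.eventually_ge_atTop _
  obtain ⟨N, ⟨h₁, h₂⟩, h₃⟩ := ((h.and (tendsto_natCast_atTop_atTop.eventually_ge_atTop L)).and
    (Filter.eventually_gt_atTop 0)).exists
  refine ⟨N, h₃, h₂, fun v w hvw => ?_⟩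
  have hpos := hℓ s(v, w) hvw
  have hN : (0 : ℝ) < N := by exact_mod_cast h₃
  have := h₁ v w hvw
  rw [div_le_iff₀ hpos] at this
  rw [div_le_iff₀ hN]
  linarith

lemma mul_truncation_error_le_one {τ : ℝ} (hτ : 2 ≤ τ) {N : ℕ} (hN : 3 * Real.log τ ≤ N) :
    (1 - 3 * Real.log τ / N) ^ N < 1 ∧
      τ * ((1 - 3 * Real.log τ / N) ^ N / (1 - (1 - 3 * Real.log τ / N) ^ N)) ≤ 1 := by
  have hτ0 : 0 < τ := by linarith
  have h := Real.one_sub_div_pow_le_exp_neg hN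
  have hexp : Real.exp (-(3 * Real.log τ)) = (τ ^ 3)⁻¹ := by
    rw [Real.exp_neg, ← Nat.cast_ofNat (R := ℝ), ← Real.log_pow, Real.exp_log (by positivity)]
  rw [hexp] at h
  set A := (1 - 3 * Real.log τ / N) ^ N
  have hcube : τ + 1 ≤ τ ^ 3 := by nlinarith [mul_pos hτ0 hτ0]
  have hA : (τ + 1) * A ≤ 1 := by
    calc (τ + 1) * A ≤ (τ + 1) * (τ ^ 3)⁻¹ := mul_le_mul_of_nonneg_left h (by linarith)
      _ ≤ τ ^ 3 * (τ ^ 3)⁻¹ := mul_le_mul_of_nonneg_right hcube (by positivity)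
      _ = 1 := mul_inv_cancel₀ (by positivity)
  have hA1 : A < 1 := by nlinarith
  refine ⟨hA1, ?_⟩
  rw [← mul_div_assoc, div_le_one (by linarith)]
  linarith

end GenericClustering

/-- **The generic clustering theorem (existence form).** There is a universal
constant `C > 0` with the following property. Let `G = (V,E,ℓ)` be a finite
weighted graph, `D > 0`, `τ ≥ 2`, and let `X ⊆ V` be a set of centers such that
every vertex has at least one center within distance `D` (covering) and at most
`τ` centers within distance `6D` (packing). Then there is a probability
distribution over collections of pairwise disjoint clusters (encoded by a map
`c : V → Option V`) such that: (1) almost surely every cluster has strong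
diameter at most `8D`; (2) every edge `{v,w}` has at least one endpoint in a
cluster while the endpoints do not share a cluster (equivalently `c v ≠ c w`)
with probability at most `C · ℓ s(v,w) · log τ / D`; and (3) every vertex is
clustered with probability at least `1/2`. -/
theorem generic_clustering :
    ∃ C : ℝ, 0 < C ∧
      ∀ (V : Type) [Fintype V] [DecidableEq V],
      ∀ (G : SimpleGraph V) (ℓ : Sym2 V → ℝ) (D τ : ℝ) (X : Set V),
        PosWeights G ℓ →
        0 < D →
        2 ≤ τ →
        (∀ v : V, ∃ x ∈ X, DistLE G ℓ Set.univ v x D) →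
        (∀ v : V,
          (Set.ncard {x | x ∈ X ∧ DistLE G ℓ Set.univ v x (6 * D)} : ℝ) ≤ τ) →
          ∃ p : (V → Option V) → ℝ,
            (∀ c, 0 ≤ p c) ∧
            (∑ c, p c) = 1 ∧
            (∀ c, p c ≠ 0 → ∀ i : V, ∀ u w : V, c u = some i → c w = some i →
              DistLE G ℓ {x | c x = some i} u w (8 * D)) ∧
            (∀ v w : V, G.Adj v w →
              (∑ c : V → Option V, if c v ≠ c w then p c else 0) ≤
                C * ℓ s(v, w) * Real.log τ / D) ∧
            (∀ v : V,
              (1 : ℝ) / 2 ≤ ∑ c : V → Option V, if c v ≠ none then p c else 0) := by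
  classical
  refine ⟨6, by norm_num, ?_⟩
  intro V _ _ G ℓ D τ X hℓ hD hτ hcover hpack
  obtain ⟨d, hd, hd', hdB⟩ := GenericClustering.exists_distance hℓ (6 * D)
  have hlog : 0 < Real.log τ := Real.log_pos (by linarith)
  obtain ⟨N, hN0, hNlog, hNℓ⟩ :=
    GenericClustering.exists_resolution hℓ D (3 * Real.log τ)
  have hN : (0 : ℝ) < N := by exact_mod_cast hN0
  obtain ⟨haN, herr⟩ := GenericClustering.mul_truncation_error_le_one hτ hNlog
  have ha0 : 0 ≤ 1 - 3 * Real.log τ / N := by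
    rw [sub_nonneg, div_le_one hN]
    exact hNlog
  have ha1 : 1 - 3 * Real.log τ / N ≤ 1 := by
    have : 0 ≤ 3 * Real.log τ / N := by positivity
    linarith
  have hstep : 1 - (1 - 3 * Real.log τ / N) = Real.log τ / D * (3 * D / N) := by
    field_simp
    ring
  generalize 1 - 3 * Real.log τ / N = a at *
  have hh : 0 < 3 * D / N := by positivity
  have hNh : N * (3 * D / N) = 3 * D := by field_simp
  generalize 3 * D / (N : ℝ) = h at *
  let e : V → ℕ := fun v => Fintype.equivFin V v
  have he : Function.Injective e := Fin.val_injective.comp (Fintype.equivFin V).injective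
  choose win hwin using fun (δ : V → Fin N) (v : V) =>
    GenericClustering.exists_isWinner (X := X.toFinset)
      (let ⟨x, hx, _⟩ := hcover v; ⟨x, Set.mem_toFinset.2 hx⟩) he
      (GenericClustering.score h d δ v)
  have hnear : ∀ δ v, d v (win δ v) ≤ 4 * D := by
    intro δ v
    obtain ⟨x, hx, hvx⟩ := hcover v
    have h₁ := (hwin δ v).le (Set.mem_toFinset.2 hx)
    have h₂ := hd' v x D hvx
    have h₃ : (((δ (win δ v) : ℕ)) : ℝ) * h ≤ N * h :=
      mul_le_mul_of_nonneg_right (by exact_mod_cast (δ (win δ v)).2.le) hh.le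
    have h₄ : 0 ≤ ((δ x : ℕ) : ℝ) * h := by positivity
    simp only [GenericClustering.score] at h₁
    linarith
  let W : (V → Fin N) → ℝ := fun δ => ∏ j, GenericClustering.truncGeom N a (δ j)
  have hW0 : ∀ δ, 0 ≤ W δ := fun δ =>
    Finset.prod_nonneg fun j _ => GenericClustering.truncGeom_nonneg ha0 ha1 _
  have hW1 : ∑ δ, W δ = 1 :=
    GenericClustering.sum_prod_eq_one _ (GenericClustering.sum_truncGeom haN.ne)
  let g : (V → Fin N) → V → Option V := fun δ v => some (win δ v)
  refine ⟨fun c => ∑ δ, if g δ = c then W δ else 0, ?_, ?_, ?_, ?_, ?_⟩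
  · exact fun c => Finset.sum_nonneg fun δ _ => by split_ifs <;> simp [hW0]
  · simpa [hW1] using GenericClustering.sum_pushforward W g fun _ => True
  · intro c hc i u w hu hw
    obtain ⟨δ, -, hδ⟩ := Finset.exists_ne_zero_of_sum_ne_zero hc
    obtain rfl : g δ = c := by
      by_contra hne
      exact hδ (if_neg hne)
    simp only [g, Option.some.injEq] at hu hw ⊢
    have := GenericClustering.distLE_cluster hd hd' hdB (hwin δ) (hnear δ) (by linarith) hu hw
    rwa [show 2 * (4 * D) = 8 * D by ring] at this
  · intro v w hvw
    have hpos : 0 < ℓ s(v, w) := hℓ _ hvw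
    let R : Finset V := {x | x ∈ X ∧ DistLE G ℓ Set.univ v x (6 * D)}
    have hRcard : (R.card : ℝ) ≤ τ := by
      have h₁ := hpack v
      rwa [Set.ncard_eq_toFinset_card', Set.toFinset_ofPred] at h₁
    have hR : ∀ δ, win δ v ∈ R := by
      intro δ
      have h₁ := hnear δ v
      obtain ⟨p, hp⟩ := hdB v (win δ v) (by linarith)
      exact Finset.mem_filter.2 ⟨Finset.mem_univ _, Set.mem_toFinset.1 (hwin δ v).1, p,
        fun _ _ => Set.mem_univ _, by linarith⟩
    have hcut := GenericClustering.prob_cut_le ha0 ha1 haN.ne hh hwin hpos.le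
      (fun x => hd v w x hvw) (fun x => by rw [Sym2.eq_swap]; exact hd w v x hvw.symm) hR
    have hr : 0 ≤ a ^ N / (1 - a ^ N) := div_nonneg (pow_nonneg ha0 _) (by linarith)
    have hfac : 1 + R.card * (a ^ N / (1 - a ^ N)) ≤ 2 := by
      linarith [mul_le_mul_of_nonneg_right hRcard hr]
    have hcount : (2 * ℓ s(v, w) / h + 1) * (1 - a) ≤ 3 * ℓ s(v, w) * Real.log τ / D := by
      have h₁ : (2 * ℓ s(v, w) / h + 1) * h ≤ 3 * ℓ s(v, w) := by
        rw [add_mul, div_mul_cancel₀ _ hh.ne']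
        linarith [hNℓ v w hvw]
      calc (2 * ℓ s(v, w) / h + 1) * (1 - a)
          = (2 * ℓ s(v, w) / h + 1) * h * (Real.log τ / D) := by rw [hstep]; ring
        _ ≤ 3 * ℓ s(v, w) * (Real.log τ / D) := mul_le_mul_of_nonneg_right h₁ (by positivity)
        _ = 3 * ℓ s(v, w) * Real.log τ / D := by ring
    calc _ = ∑ δ, W δ * (if g δ v ≠ g δ w then 1 else 0) := by
          rw [← GenericClustering.sum_pushforward W g fun c => c v ≠ c w]
      _ = ∑ δ, W δ * (if win δ v ≠ win δ w then 1 else 0) := by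
          simp only [g, ne_eq, Option.some.injEq]
      _ ≤ (2 * ℓ s(v, w) / h + 1) * (1 - a) * (1 + R.card * (a ^ N / (1 - a ^ N))) := hcut
      _ ≤ (2 * ℓ s(v, w) / h + 1) * (1 - a) * 2 :=
          mul_le_mul_of_nonneg_left hfac (mul_nonneg (by positivity) (by linarith))
      _ ≤ 6 * ℓ s(v, w) * Real.log τ / D := by
          have : 6 * ℓ s(v, w) * Real.log τ / D = 3 * ℓ s(v, w) * Real.log τ / D * 2 := by ring
          linarith
  · intro v
    have : ∑ c : V → Option V, (if c v ≠ none then ∑ δ, (if g δ = c then W δ else 0) else 0) =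
        1 := by
      rw [GenericClustering.sum_pushforward W g fun c => c v ≠ none]
      simp [g, hW1]
    refine le_trans (by norm_num) (this.symm.le.trans_eq ?_)
    exact Finset.sum_congr rfl fun c _ => by congr
end

section
/- Let (V,d) be a finite pseudometric space with n points, let D' > 0 be a distance parameter, and let c > 1 be a real number. Suppose there exists a set Z ⊆ V with |Z| ≥ n/c such that every v ∈ Z satisfies |B(v, 2D')| ≤ (1 − 1/c)·n. Then every v ∈ V satisfies |B(v, D')| ≤ (1 − 1/c)·n. -/
/-- Let `(V,d)` be a finite pseudometric space with `n` points, `D' > 0` and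
`c > 1`. If there is a set `Z ⊆ V` with `|Z| ≥ n/c` such that every `v ∈ Z`
satisfies `|B(v, 2D')| ≤ (1 − 1/c)·n`, then every `v ∈ V` satisfies
`|B(v, D')| ≤ (1 − 1/c)·n`. -/
theorem ball_card_le_of_core_set {V : Type} [Fintype V] [PseudoMetricSpace V]
    (D' c : ℝ) (hD' : 0 < D') (hc : 1 < c) (Z : Set V)
    (hZcard : (Fintype.card V : ℝ) / c ≤ (Z.ncard : ℝ))
    (hZ : ∀ v ∈ Z,
      (Set.ncard {u : V | dist v u ≤ 2 * D'} : ℝ) ≤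
        (1 - 1 / c) * (Fintype.card V : ℝ)) :
    ∀ v : V,
      (Set.ncard {u : V | dist v u ≤ D'} : ℝ) ≤
        (1 - 1 / c) * (Fintype.card V : ℝ) := by
  intro v
  by_cases h : ∃ z ∈ Z, dist v z ≤ D'
  · obtain ⟨z, hz, hvz⟩ := h
    refine le_trans ?_ (hZ z hz)
    have hsub : {u : V | dist v u ≤ D'} ⊆ {u : V | dist z u ≤ 2 * D'} := by
      intro u hu
      have hu' : dist v u ≤ D' := hu
      have htri := dist_triangle_left z u v
      change dist z u ≤ 2 * D'
      linarith
    exact_mod_cast Set.ncard_le_ncard hsub (Set.toFinite _)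
  · push Not at h
    have hsub : {u : V | dist v u ≤ D'} ⊆ Zᶜ :=
      fun u hu huZ => (h u huZ).not_ge hu
    have hball : (Set.ncard {u : V | dist v u ≤ D'} : ℝ) ≤ (Zᶜ.ncard : ℝ) := by
      exact_mod_cast Set.ncard_le_ncard hsub (Set.toFinite _)
    have hcompl : (Z.ncard : ℝ) + (Zᶜ.ncard : ℝ) = (Fintype.card V : ℝ) := by
      rw [← Nat.card_eq_fintype_card]
      exact_mod_cast Set.ncard_add_ncard_compl Z
    have hsplit : (1 - 1 / c) * (Fintype.card V : ℝ) =
        (Fintype.card V : ℝ) - (Fintype.card V : ℝ) / c := by ring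
    linarith
end

section
/- For all real numbers λ > 0, ρ ∈ ℝ, γ' > 0 and ε' > 0, the following integral inequality holds: ∫_{ρ−ε'}^{min(1, ρ+γ')} λ·e^{−λy}/(1 − e^{−λ}) dy ≤ (1 − e^{−λ(γ'+ε')}) · e^{2ε'λ} · ( (e^{−(ρ+ε')λ} − e^{−λ})/(1 − e^{−λ}) + 1/(e^{λ} − 1) ). -/
/-- For all real `λ > 0`, `ρ`, `γ' > 0` and `ε' > 0`:
`∫_{ρ−ε'}^{min(1, ρ+γ')} λ·e^{−λy}/(1 − e^{−λ}) dy
  ≤ (1 − e^{−λ(γ'+ε')}) · e^{2ε'λ} · ((e^{−(ρ+ε')λ} − e^{−λ})/(1 − e^{−λ}) + 1/(e^λ − 1))`. -/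
theorem truncated_exp_integral_bound (lam ρ γ' ε' : ℝ)
    (hlam : 0 < lam) (hγ' : 0 < γ') (hε' : 0 < ε') :
    (∫ y in (ρ - ε')..(min 1 (ρ + γ')),
        lam * Real.exp (-(lam * y)) / (1 - Real.exp (-lam))) ≤
      (1 - Real.exp (-(lam * (γ' + ε')))) * Real.exp (2 * ε' * lam) *
        ((Real.exp (-((ρ + ε') * lam)) - Real.exp (-lam)) / (1 - Real.exp (-lam)) +
          1 / (Real.exp lam - 1)) := by
  have hD : 0 < 1 - Real.exp (-lam) := by
    have : Real.exp (-lam) < 1 := Real.exp_lt_one_iff.mpr (by linarith)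
    linarith
  have hint : ∀ a b : ℝ, (∫ y in a..b, lam * Real.exp (-(lam * y)) / (1 - Real.exp (-lam))) =
      (Real.exp (-(lam * a)) - Real.exp (-(lam * b))) / (1 - Real.exp (-lam)) := by
    intro a b
    have hderiv : ∀ y ∈ Set.uIcc a b,
        HasDerivAt (fun y : ℝ => -Real.exp (-(lam * y)) / (1 - Real.exp (-lam)))
          (lam * Real.exp (-(lam * y)) / (1 - Real.exp (-lam))) y := by
      intro y _
      have h := ((((hasDerivAt_id' y).const_mul lam).fun_neg.exp).fun_neg).div_const
        (1 - Real.exp (-lam))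
      refine h.congr_deriv ?_
      ring
    rw [intervalIntegral.integral_eq_sub_of_hasDerivAt hderiv
      (Continuous.intervalIntegrable (by fun_prop) a b)]
    ring
  have hinv : 1 / (Real.exp lam - 1) = Real.exp (-lam) / (1 - Real.exp (-lam)) := by
    have h1 : 0 < Real.exp lam - 1 := by
      have := Real.one_lt_exp_iff.mpr hlam
      linarith
    rw [div_eq_div_iff h1.ne' hD.ne', mul_sub (Real.exp (-lam)), ← Real.exp_add]
    simp
  have hrhs : (1 - Real.exp (-(lam * (γ' + ε')))) * Real.exp (2 * ε' * lam) *
      Real.exp (-((ρ + ε') * lam)) =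
      Real.exp (-(lam * (ρ - ε'))) - Real.exp (-(lam * (ρ + γ'))) := by
    rw [mul_assoc, ← Real.exp_add, sub_mul, one_mul, ← Real.exp_add]
    ring_nf
  rw [hint, hinv, ← add_div, sub_add_cancel, ← mul_div_assoc, hrhs]
  gcongr
  exact min_le_right _ _
end

section
/- For all real numbers λ > 0, ρ ∈ ℝ, γ' > 0 and γ > 0, the following integral inequality holds: ∫_{ρ−γ'}^{min(1, ρ+γ)} λ·e^{−λy}/(1 − e^{−λ}) dy ≤ (1 − e^{−λ(γ'+γ)}) · e^{λγ'} · ( (e^{−λρ} − e^{−λ})/(1 − e^{−λ}) + 1/(e^{λ} − 1) ). -/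
/-- For all real `λ > 0`, `ρ`, `γ' > 0` and `γ > 0`:
`∫_{ρ−γ'}^{min(1, ρ+γ)} λ·e^{−λy}/(1 − e^{−λ}) dy
  ≤ (1 − e^{−λ(γ'+γ)}) · e^{λγ'} · ((e^{−λρ} − e^{−λ})/(1 − e^{−λ}) + 1/(e^λ − 1))`. -/
theorem truncated_exp_integral_bound' (lam ρ γ' γ : ℝ)
    (hlam : 0 < lam) (hγ' : 0 < γ') (hγ : 0 < γ) :
    (∫ y in (ρ - γ')..(min 1 (ρ + γ)),
        lam * Real.exp (-(lam * y)) / (1 - Real.exp (-lam))) ≤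
      (1 - Real.exp (-(lam * (γ' + γ)))) * Real.exp (lam * γ') *
        ((Real.exp (-(lam * ρ)) - Real.exp (-lam)) / (1 - Real.exp (-lam)) +
          1 / (Real.exp lam - 1)) := by
  have hD : 0 < 1 - Real.exp (-lam) := by
    have : Real.exp (-lam) < 1 := Real.exp_lt_one_iff.mpr (by linarith)
    linarith
  have hint : (∫ y in (ρ - γ')..(min 1 (ρ + γ)),
      lam * Real.exp (-(lam * y)) / (1 - Real.exp (-lam))) =
      (Real.exp (-(lam * (ρ - γ'))) - Real.exp (-(lam * min 1 (ρ + γ)))) /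
        (1 - Real.exp (-lam)) := by
    have hderiv : ∀ y ∈ Set.uIcc (ρ - γ') (min 1 (ρ + γ)),
        HasDerivAt (fun y : ℝ => -Real.exp (-(lam * y)) / (1 - Real.exp (-lam)))
          (lam * Real.exp (-(lam * y)) / (1 - Real.exp (-lam))) y := by
      intro y _
      have hexp : HasDerivAt (fun y : ℝ => Real.exp (-(lam * y)))
          (Real.exp (-(lam * y)) * -(lam * 1)) y :=
        ((hasDerivAt_id y).const_mul lam).neg.exp
      exact (hexp.neg.div_const (1 - Real.exp (-lam))).congr_deriv (by ring)
    rw [intervalIntegral.integral_eq_sub_of_hasDerivAt hderiv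
      (Continuous.intervalIntegrable (by fun_prop) _ _)]
    ring
  have hbracket : (Real.exp (-(lam * ρ)) - Real.exp (-lam)) / (1 - Real.exp (-lam)) +
      1 / (Real.exp lam - 1) = Real.exp (-(lam * ρ)) / (1 - Real.exp (-lam)) := by
    have hinv : 1 / (Real.exp lam - 1) = Real.exp (-lam) / (1 - Real.exp (-lam)) := by
      have hpos : 0 < Real.exp lam - 1 := by
        have := Real.one_lt_exp_iff.mpr hlam
        linarith
      rw [div_eq_div_iff hpos.ne' hD.ne', mul_sub (Real.exp (-lam)), ← Real.exp_add]
      simp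
    rw [hinv]
    ring
  have hprod : (1 - Real.exp (-(lam * (γ' + γ)))) * Real.exp (lam * γ') *
      Real.exp (-(lam * ρ)) =
      Real.exp (-(lam * (ρ - γ'))) - Real.exp (-(lam * (ρ + γ))) := by
    rw [sub_mul, sub_mul, one_mul, ← Real.exp_add, ← Real.exp_add, ← Real.exp_add]
    ring_nf
  have hmin : Real.exp (-(lam * (ρ + γ))) ≤ Real.exp (-(lam * min 1 (ρ + γ))) := by
    gcongr
    exact min_le_right _ _
  rw [hint, hbracket, ← mul_div_assoc, hprod]
  gcongr
end

section
/- Let λ ≥ 1 and c_b ≥ 8 be real numbers, set γ' := 1/(2·c_b·λ), and let γ_z, c₁, c₂, E be real numbers with 0 ≤ γ_z ≤ γ', c₁ ≥ 1, c₂ ≥ 0, and 0 ≤ E ≤ c₁·e^{(λ+c₂)(1+γ')}. Then (1 − e^{−λ(γ'+γ_z)}) · e^{λγ'} · (1 + E/(e^{λ} − 1)) ≤ 10·(2·c₁·e^{3c₂})·λ·γ' (which equals 10·c₁·e^{3c₂}/c_b). (Explicit form of the paper's Lemma bounding the sum of cut probabilities for bounded blurry ball carving.) -/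
/-- **Bound on the total cut probability of bounded blurry ball carving
(explicit form).** Let `λ ≥ 1`, `c_b ≥ 8`, `γ' := 1/(2·c_b·λ)`, and let
`γ_z, c₁, c₂, E` satisfy `0 ≤ γ_z ≤ γ'`, `c₁ ≥ 1`, `c₂ ≥ 0`, and
`0 ≤ E ≤ c₁·e^{(λ+c₂)(1+γ')}`. Then
`(1 − e^{−λ(γ'+γ_z)}) · e^{λγ'} · (1 + E/(e^λ − 1)) ≤ 10·(2·c₁·e^{3c₂})·λ·γ'`. -/
theorem blurry_ball_carving_cut_bound (lam cb γ' γz c₁ c₂ E : ℝ)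
    (hlam : 1 ≤ lam) (hcb : 8 ≤ cb) (hγ' : γ' = 1 / (2 * cb * lam))
    (hγz0 : 0 ≤ γz) (hγz : γz ≤ γ') (hc₁ : 1 ≤ c₁) (hc₂ : 0 ≤ c₂)
    (hE0 : 0 ≤ E) (hE : E ≤ c₁ * Real.exp ((lam + c₂) * (1 + γ'))) :
    (1 - Real.exp (-(lam * (γ' + γz)))) * Real.exp (lam * γ') *
        (1 + E / (Real.exp lam - 1)) ≤
      10 * (2 * c₁ * Real.exp (3 * c₂)) * lam * γ' := by
  have hlam0 : 0 < lam := by linarith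
  have hcb0 : 0 < cb := by linarith
  have hx : lam * γ' = 1 / (2 * cb) := by
    rw [hγ']
    field_simp
  have hx0 : 0 ≤ lam * γ' := by
    rw [hx]
    positivity
  have hx1 : lam * γ' ≤ 1 / 16 := by
    rw [hx]
    exact one_div_le_one_div_of_le (by norm_num) (by linarith)
  have hγ0 : 0 ≤ γ' := hγz0.trans hγz
  have hγ1 : γ' ≤ 1 := by nlinarith
  have hexp_two : Real.exp (lam * γ') ≤ 2 := by
    have h := Real.add_one_le_exp (-(lam * γ'))
    have hmul : Real.exp (-(lam * γ')) * Real.exp (lam * γ') = 1 := by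
      rw [← Real.exp_add, neg_add_cancel, Real.exp_zero]
    nlinarith [Real.exp_pos (lam * γ')]
  have hexp_lam : 2 ≤ Real.exp lam := by linarith [Real.add_one_le_exp lam]
  set K := c₁ * Real.exp (3 * c₂) with hK
  have hK1 : 1 ≤ K := one_le_mul_of_one_le_of_one_le hc₁ (Real.one_le_exp (by positivity))
  have hfactor : 1 - Real.exp (-(lam * (γ' + γz))) ≤ 2 * (lam * γ') := by
    nlinarith [Real.add_one_le_exp (-(lam * (γ' + γz)))]
  have hEK : E ≤ K * (Real.exp lam * Real.exp (lam * γ')) := by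
    refine hE.trans ?_
    rw [hK, mul_assoc, ← Real.exp_add, ← Real.exp_add]
    gcongr
    nlinarith
  have hratio : E / (Real.exp lam - 1) ≤ 4 * K := by
    rw [div_le_iff₀ (by linarith)]
    calc
      E ≤ K * (Real.exp lam * Real.exp (lam * γ')) := hEK
      _ ≤ K * (2 * (Real.exp lam - 1) * 2) := by
        gcongr <;> linarith
      _ = 4 * K * (Real.exp lam - 1) := by ring
  have hratio0 : 0 ≤ E / (Real.exp lam - 1) := div_nonneg hE0 (by linarith)
  calc
    _ ≤ 2 * (lam * γ') * 2 * (5 * K) := by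
      gcongr
      linarith
    _ = 10 * (2 * c₁ * Real.exp (3 * c₂)) * lam * γ' := by
      rw [hK]
      ring
end

section
/- Let τ ≥ 3 be a real number and set λ := 2·ln τ + 2. Let γ, ε, ε_u ≥ 0 be real numbers, set ε_l := ε + ε_u, and assume γ + 5ε_l + ε_u ≤ 1/4 and 2·ε_u·λ ≤ 1. Then (1 − e^{−2(γ+5ε_l+ε_u)λ}) · e^{2ε_uλ} · (1 + τ/(e^{λ} − 1)) ≤ 1 − e^{−16(γ+5ε)·ln τ} + 160·ε_u·ln τ. (Analytic core of the paper's Lemma 'Random Shift with Approximate Distances', bounding the total probability of the bad events C_i.) -/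
/-- **Analytic core of the random-shift Lemma with approximate distances.**
Let `τ ≥ 3`, `λ := 2·ln τ + 2`, let `γ, ε, ε_u ≥ 0`, `ε_l := ε + ε_u`, and
assume `γ + 5ε_l + ε_u ≤ 1/4` and `2·ε_u·λ ≤ 1`. Then
`(1 − e^{−2(γ+5ε_l+ε_u)λ}) · e^{2ε_uλ} · (1 + τ/(e^λ − 1))
  ≤ 1 − e^{−16(γ+5ε)·ln τ} + 160·ε_u·ln τ`. -/
theorem random_shift_bad_events_bound (τ γ ε εu lam εl : ℝ)
    (hτ : 3 ≤ τ) (hγ : 0 ≤ γ) (hε : 0 ≤ ε) (hεu : 0 ≤ εu)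
    (hlam : lam = 2 * Real.log τ + 2) (hεl : εl = ε + εu)
    (hsum : γ + 5 * εl + εu ≤ 1 / 4) (h2 : 2 * εu * lam ≤ 1) :
    (1 - Real.exp (-(2 * (γ + 5 * εl + εu) * lam))) * Real.exp (2 * εu * lam) *
        (1 + τ / (Real.exp lam - 1)) ≤
      1 - Real.exp (-(16 * (γ + 5 * ε) * Real.log τ)) + 160 * εu * Real.log τ := by
  have hτ0 : 0 < τ := by linarith
  have hL : 1 ≤ Real.log τ := by
    rw [Real.le_log_iff_exp_le hτ0]
    linarith [Real.exp_one_lt_d9]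
  subst hεl
  set L := Real.log τ with hLdef
  obtain ⟨g, hg⟩ : ∃ g, g = γ + 5 * ε := ⟨_, rfl⟩
  have hg0 : 0 ≤ g := by rw [hg]; positivity
  obtain ⟨y, hy⟩ : ∃ y, y = 2 * εu * lam := ⟨_, rfl⟩
  have hlam0 : 0 < lam := by linarith
  have hy0 : 0 ≤ y := by rw [hy]; positivity
  have hy1 : y ≤ 1 := by linarith
  obtain ⟨q, hq⟩ : ∃ q, q = Real.exp (-(2 * g * lam)) := ⟨_, rfl⟩
  have hq0 : 0 < q := by rw [hq]; exact Real.exp_pos _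
  have hq1 : q ≤ 1 := by
    rw [hq, Real.exp_le_one_iff]
    have : 0 ≤ 2 * g * lam := by positivity
    linarith
  -- The correction `τ / (exp lam - 1)` is at most `exp (-(lam / 2)) ≤ q`.
  obtain ⟨m, hm⟩ : ∃ m, m = Real.exp (L + 1) := ⟨_, rfl⟩
  have hmτ : 2 * τ ≤ m := by
    rw [hm, Real.exp_add, hLdef, Real.exp_log hτ0]
    nlinarith [Real.exp_one_gt_d9]
  have hm0 : 0 < m := by linarith
  have hexp : Real.exp lam = m ^ 2 := by
    rw [hm, ← Real.exp_nat_mul, hlam]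
    congr 1
    push_cast
    ring
  have hmq : m⁻¹ ≤ q := by
    rw [hm, hq, ← Real.exp_neg, Real.exp_le_exp]
    have : g ≤ 1 / 4 := by linarith
    nlinarith
  have hδm : τ / (Real.exp lam - 1) ≤ m⁻¹ := by
    rw [hexp, inv_eq_one_div, div_le_div_iff₀ (by nlinarith) hm0]
    nlinarith
  obtain ⟨δ, hδ⟩ : ∃ δ, δ = τ / (Real.exp lam - 1) := ⟨_, rfl⟩
  have hδ0 : 0 ≤ δ := by
    rw [hδ, hexp]
    exact div_nonneg hτ0.le (by nlinarith)
  rw [← hδ] at hδm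
  have hδq : δ ≤ q := hδm.trans hmq
  have hleft : (1 - Real.exp (-(2 * (γ + 5 * (ε + εu) + εu) * lam))) * Real.exp (2 * εu * lam)
      ≤ 1 - q + 7 * y := by
    have hsplit : Real.exp (-(2 * (γ + 5 * (ε + εu) + εu) * lam)) * Real.exp (2 * εu * lam)
        = q * Real.exp (-(5 * y)) := by
      rw [hq, ← Real.exp_add, ← Real.exp_add, hy, hg]
      congr 1
      ring
    have hexpy : Real.exp y ≤ 1 + 2 * y := by
      have h := Real.abs_exp_sub_one_le (x := y) (by rwa [abs_of_nonneg hy0])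
      rw [abs_of_nonneg hy0] at h
      linarith [le_abs_self (Real.exp y - 1)]
    have hexp5 : 1 - 5 * y ≤ Real.exp (-(5 * y)) := by
      linarith [Real.add_one_le_exp (-(5 * y))]
    rw [sub_mul, one_mul, hsplit, ← hy]
    nlinarith [mul_le_mul_of_nonneg_left hexp5 hq0.le, mul_nonneg hy0 (sub_nonneg.2 hq1)]
  have hright : Real.exp (-(16 * (γ + 5 * ε) * L)) ≤ q ^ 2 := by
    rw [hq, ← Real.exp_nat_mul, Real.exp_le_exp, ← hg]
    push_cast
    nlinarith [mul_nonneg hg0 (sub_nonneg.2 hL)]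
  have hlin : 20 * y ≤ 160 * εu * L := by
    rw [hy]
    nlinarith [mul_nonneg hεu (sub_nonneg.2 hL)]
  rw [← hδ]
  have hmul := mul_le_mul_of_nonneg_right hleft (by linarith : 0 ≤ 1 + δ)
  nlinarith [mul_nonneg (sub_nonneg.2 hδq) (sub_nonneg.2 hq1),
    mul_nonneg hy0 (sub_nonneg.2 (hδq.trans hq1))]
end

section
/- Let (V,d) be a pseudometric space, let D > 0, let ε_p ∈ (0,1] and ε_s ∈ (0,1], and let c ≥ 1. Let s ∈ V, and let p₁, …, p_m ∈ V be points together with real parameters t₁ ≤ t₂ ≤ … ≤ t_m such that t_{i+1} − t_i ≥ ε_p·D for all i < m, and such that for every i: d(s,p_i) ≤ t_i ≤ (1+ε_s)·d(s,p_i) and t_i ≤ D/ε_s. Then for every point v ∈ V, the number of indices i with d(v,p_i) ≤ c·D is at most 10·c/ε_p + 1. (Abstract form of the paper's net-distance Lemma: an ε_p·D-net on a (1+ε_s)-approximate shortest path of length D·ε_s^{-1} has at most O(c·ε_p^{-1}) net points within distance c·D of any vertex.) -/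
/-- A sequence on `Fin m` whose consecutive gaps are at least `δ` has gap at least `(j - i) * δ`
between any indices `i ≤ j`. -/
theorem sub_mul_le_sub_of_consecutive_gap {m : ℕ} {t : Fin m → ℝ} {δ : ℝ}
    (hgap : ∀ i j : Fin m, (i : ℕ) + 1 = (j : ℕ) → δ ≤ t j - t i)
    {i j : Fin m} (hij : i ≤ j) : ((j : ℝ) - (i : ℝ)) * δ ≤ t j - t i := by
  have key : ∀ (k : ℕ) (j : Fin m), (i : ℕ) + k = j → (k : ℝ) * δ ≤ t j - t i := by
    intro k
    induction k with
    | zero =>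
      intro j hj
      have : i = j := Fin.ext (by simpa using hj)
      simp [this]
    | succ k ih =>
      intro j hj
      have hlt : (i : ℕ) + k < m := by have := j.isLt; omega
      have h₁ := ih ⟨i + k, hlt⟩ rfl
      have h₂ := hgap ⟨i + k, hlt⟩ j (by simp; omega)
      push_cast
      linarith
  have hle : (i : ℕ) ≤ j := hij
  have h := key (j - i) j (by omega)
  rwa [Nat.cast_sub hle] at h

/-- A set of indices on which a sequence with consecutive gaps at least `δ` varies by at most `L`
has at most `L / δ + 1` elements. -/
theorem ncard_le_div_add_one_of_consecutive_gap {m : ℕ} {t : Fin m → ℝ} {δ L : ℝ}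
    (hδ : 0 < δ) (hL : 0 ≤ L)
    (hgap : ∀ i j : Fin m, (i : ℕ) + 1 = (j : ℕ) → δ ≤ t j - t i)
    (S : Set (Fin m)) (hS : ∀ i ∈ S, ∀ j ∈ S, t j - t i ≤ L) :
    (S.ncard : ℝ) ≤ L / δ + 1 := by
  rcases S.eq_empty_or_nonempty with rfl | hne
  · simp only [Set.ncard_empty, Nat.cast_zero]
    positivity
  obtain ⟨a, ha, hmin⟩ := Set.exists_min_image S id S.toFinite hne
  obtain ⟨b, hb, hmax⟩ := Set.exists_max_image S id S.toFinite hne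
  have hab : a ≤ b := hmin b hb
  have hcard : S.ncard ≤ (b : ℕ) + 1 - a := by
    calc S.ncard ≤ (Finset.Icc a b : Set (Fin m)).ncard :=
          Set.ncard_le_ncard (fun i hi => by simpa using ⟨hmin i hi, hmax i hi⟩)
            (Set.toFinite _)
      _ = (b : ℕ) + 1 - a := by rw [Set.ncard_coe_finset, Fin.card_Icc]
  have hnat : S.ncard + (a : ℕ) ≤ (b : ℕ) + 1 := by
    have : (a : ℕ) ≤ b := hab
    omega
  have hreal : (S.ncard : ℝ) + (a : ℕ) ≤ (b : ℕ) + 1 := by exact_mod_cast hnat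
  have hdiv : ((b : ℝ) - (a : ℝ)) ≤ L / δ :=
    (le_div_iff₀ hδ).2 ((sub_mul_le_sub_of_consecutive_gap hgap hab).trans (hS a ha b hb))
  linarith


/-- **Net points on an approximate shortest path (abstract form).** Let `(V,d)`
be a pseudometric space, `D > 0`, `ε_p, ε_s ∈ (0,1]`, `c ≥ 1`. Let `s ∈ V` and
let `p₁, …, p_m ∈ V` be points with real parameters `t₁ ≤ … ≤ t_m` (the
along-path distances) such that consecutive parameters differ by at least
`ε_p·D`, and for every `i`: `d(s,p_i) ≤ t_i ≤ (1+ε_s)·d(s,p_i)` and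
`t_i ≤ D/ε_s`. Then for every `v ∈ V`, the number of indices `i` with
`d(v,p_i) ≤ c·D` is at most `10·c/ε_p + 1`. -/
theorem net_points_in_ball_le {V : Type} [PseudoMetricSpace V]
    (D εp εs c : ℝ) (hD : 0 < D) (hεp0 : 0 < εp) (hεp1 : εp ≤ 1)
    (hεs0 : 0 < εs) (hεs1 : εs ≤ 1) (hc : 1 ≤ c)
    (s : V) (m : ℕ) (p : Fin m → V) (t : Fin m → ℝ)
    (hgap : ∀ i j : Fin m, (i : ℕ) + 1 = (j : ℕ) → εp * D ≤ t j - t i)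
    (hlow : ∀ i, dist s (p i) ≤ t i)
    (hupp : ∀ i, t i ≤ (1 + εs) * dist s (p i))
    (hlen : ∀ i, t i ≤ D / εs) :
    ∀ v : V,
      (Set.ncard {i : Fin m | dist v (p i) ≤ c * D} : ℝ) ≤ 10 * c / εp + 1 := by
  intro v
  have hS : ∀ i ∈ {i : Fin m | dist v (p i) ≤ c * D},
      ∀ j ∈ {i : Fin m | dist v (p i) ≤ c * D}, t j - t i ≤ 10 * c * D := by
    intro i hi j hj
    simp only [Set.mem_ofPred_eq] at hi hj
    have htri : dist s (p j) ≤ dist s (p i) + dist v (p i) + dist v (p j) := by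
      have := dist_triangle4 s (p i) v (p j)
      rwa [dist_comm (p i) v] at this
    have hslack : εs * dist s (p j) ≤ D := by
      have h := (le_div_iff₀ hεs0).1 ((hlow j).trans (hlen j))
      linarith
    have hcD : D ≤ c * D := le_mul_of_one_le_left hD.le hc
    linarith [hupp j, hlow i]
  have h := ncard_le_div_add_one_of_consecutive_gap (mul_pos hεp0 hD)
    (by positivity) hgap _ hS
  rwa [mul_div_mul_right _ _ hD.ne'] at h
end

section
/- There is a universal constant C > 0 with the following property. Let G = (V,E,ℓ) be a weighted k-path separable graph with n ≥ 2 vertices whose weighted diameter is at most D, and let ε ∈ (0,1]. Then there exist κ ≤ C·ε^{−1}·k·log n simple paths P₁, …, P_κ in G, each of total length at most 4D, together with vertex sets B₁, …, B_κ where each B_i ⊆ B_G(P_i, ε·D), such that every vertex v of G that does not belong to any P_i or B_i satisfies |B_{G∖S}(v, D)| ≤ (7/8)·n, where S is the union of all vertices of the paths P_i and the sets B_i and G∖S is the graph obtained from G by deleting these vertices. (Existence form of the paper's Theorem on weak separators for k-path separable graphs.) -/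
open SimpleGraph

section Defs

variable {V : Type} [Fintype V] [DecidableEq V]

/-- A (simple) path in `G`, bundled with its endpoints. -/
structure PathIn (G : SimpleGraph V) where
  src : V
  dst : V
  walk : G.Walk src dst
  isPath : walk.IsPath

/-- The set of vertices lying on some path of the list `L`. -/
def pathSupp {G : SimpleGraph V} (L : List (PathIn G)) : Set V :=
  {x | ∃ p ∈ L, x ∈ p.walk.support}

/-- The set of vertices lying on some path of some group in `L`. -/
def suppL {G : SimpleGraph V} (L : List (List (PathIn G))) : Set V :=
  {x | ∃ ps ∈ L, ∃ p ∈ ps, x ∈ p.walk.support}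

/-- `p` is a shortest path of the subgraph induced on `A`. -/
def IsShortestPathIn (G : SimpleGraph V) (ℓ : Sym2 V → ℝ) (A : Set V) (p : PathIn G) : Prop :=
  WalkIn A p.walk ∧ ∀ q : G.Walk p.src p.dst, WalkIn A q → wlen ℓ p.walk ≤ wlen ℓ q

/-- The induced subgraph of `G` on the vertex set `A` is `k`-path separable:
there is a sequence of groups of paths, each path being a shortest path of the
graph obtained by deleting the vertices of all previous groups, with at most `k`
paths in total, such that after deleting all these paths every connected component
has at most half as many vertices, and the remaining graph is empty or itself
`k`-path separable. -/
inductive KPathSep (G : SimpleGraph V) (ℓ : Sym2 V → ℝ) (k : ℕ) : Set V → Prop where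
  | step : ∀ (A : Set V) (L : List (List (PathIn G))),
      (L.map List.length).sum ≤ k →
      (∀ i : Fin L.length, ∀ p ∈ L.get i,
        IsShortestPathIn G ℓ (A \ suppL (L.take i)) p) →
      (∀ v ∈ A \ suppL L,
        2 * Set.ncard {w | w ∈ A \ suppL L ∧ ∃ q : G.Walk v w, WalkIn (A \ suppL L) q}
          ≤ Set.ncard A) →
      (A \ suppL L ≠ ∅ → KPathSep G ℓ k (A \ suppL L)) →
      KPathSep G ℓ k A

/-- `G` is universally `k`-path separable: it is `k`-path separable
for every positive edge-length function. -/
def UnivKPathSeparable (G : SimpleGraph V) (k : ℕ) : Prop :=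
  ∀ ℓ : Sym2 V → ℝ, PosWeights G ℓ → KPathSep G ℓ k Set.univ

end Defs

section WeakSeparator

variable {V : Type} {G : SimpleGraph V} {ℓ : Sym2 V → ℝ}

lemma walkIn_append {A : Set V} {u v w : V} {p : G.Walk u v} {q : G.Walk v w} :
    WalkIn A (p.append q) ↔ WalkIn A p ∧ WalkIn A q := by
  simp only [WalkIn, Walk.mem_support_append_iff]
  grind

lemma walkIn_reverse {A : Set V} {u v : V} {p : G.Walk u v} :
    WalkIn A p.reverse ↔ WalkIn A p := by
  simp [WalkIn]

lemma WalkIn.mono {A B : Set V} (h : A ⊆ B) {u v : V} {p : G.Walk u v} (hp : WalkIn A p) :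
    WalkIn B p := fun x hx => h (hp x hx)

lemma DistLE.symm {A : Set V} {u v : V} {r : ℝ} (h : DistLE G ℓ A u v r) :
    DistLE G ℓ A v u r := by
  obtain ⟨p, hp, hl⟩ := h
  exact ⟨p.reverse, walkIn_reverse.2 hp, (wlen_reverse p).trans_le hl⟩

lemma DistLE.trans {A : Set V} {u v w : V} {r s : ℝ} (h : DistLE G ℓ A u v r)
    (h' : DistLE G ℓ A v w s) : DistLE G ℓ A u w (r + s) := by
  obtain ⟨p, hp, hl⟩ := h
  obtain ⟨q, hq, hl'⟩ := h'
  exact ⟨p.append q, walkIn_append.2 ⟨hp, hq⟩, (wlen_append p q).trans_le (add_le_add hl hl')⟩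

lemma DistLE.mono {A B : Set V} (hAB : A ⊆ B) {u v : V} {r : ℝ} (h : DistLE G ℓ A u v r) :
    DistLE G ℓ B u v r := by
  obtain ⟨p, hp, hl⟩ := h
  exact ⟨p, hp.mono hAB, hl⟩

/-- Every vertex on a walk is at most as far from the start as the walk is long. -/
lemma distLE_of_mem_support (hℓ : PosWeights G ℓ) {A : Set V} {u v x : V} {r : ℝ}
    (p : G.Walk u v) (hp : WalkIn A p) (hl : wlen ℓ p ≤ r) (hx : x ∈ p.support) :
    DistLE G ℓ A u x r := by
  obtain ⟨q, q', rfl⟩ := Walk.mem_support_iff_exists_append.1 hx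
  refine ⟨q, (walkIn_append.1 hp).1, le_trans ?_ hl⟩
  rw [wlen_append]
  linarith [wlen_nonneg hℓ q']

/-- A walk meeting `X` splits at its first vertex in `X`. -/
lemma exists_append_first_mem (X : Set V) {u v : V} (p : G.Walk u v)
    (h : ∃ z ∈ X, z ∈ p.support) :
    ∃ x ∈ X, ∃ (a : G.Walk u x) (b : G.Walk x v), p = a.append b ∧
      ∀ z ∈ X, z ∈ p.support → z ∈ b.support := by
  induction p with
  | @nil u =>
    obtain ⟨z, hz, hz'⟩ := h
    obtain rfl : z = u := by simpa using hz'
    exact ⟨z, hz, .nil, .nil, rfl, fun _ _ h => h⟩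
  | @cons u w v e p ih =>
    by_cases hu : u ∈ X
    · exact ⟨u, hu, .nil, .cons e p, rfl, fun _ _ h => h⟩
    · have aux : ∀ z ∈ X, z ∈ (Walk.cons e p).support → z ∈ p.support := by
        intro z hz hz'
        rw [Walk.support_cons, List.mem_cons] at hz'
        rcases hz' with rfl | hz'
        · exact absurd hz hu
        · exact hz'
      obtain ⟨z, hz, hz'⟩ := h
      obtain ⟨x, hx, a, b, rfl, hab⟩ := ih ⟨z, hz, aux z hz hz'⟩
      exact ⟨x, hx, .cons e a, b, rfl, fun z hz hz' => hab z hz (aux z hz hz')⟩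

/-- A walk meeting `X` splits at its first and last vertices in `X`. -/
lemma exists_append_first_last_mem (X : Set V) {u v : V} (p : G.Walk u v)
    (h : ∃ z ∈ X, z ∈ p.support) :
    ∃ x ∈ X, ∃ y ∈ X, ∃ (a : G.Walk u x) (b : G.Walk x y) (c : G.Walk y v),
      p = a.append (b.append c) ∧ ∀ z ∈ X, z ∈ p.support → z ∈ b.support := by
  obtain ⟨x, hx, a, q, rfl, haq⟩ := exists_append_first_mem X p h
  obtain ⟨y, hy, c, b, hq, hcb⟩ :=
    exists_append_first_mem X q.reverse ⟨x, hx, by simp⟩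
  refine ⟨x, hx, y, hy, a, b.reverse, c.reverse, ?_, fun z hz hz' => ?_⟩
  · rw [← Walk.reverse_append, ← hq, Walk.reverse_reverse]
  · simpa using hcb z hz (by simpa using haq z hz hz')

/-- If the vertices of `X` are pairwise within distance `r` in `A`, then a shortest path of `A`
contains a subpath of length at most `r` covering all its vertices in `X`. -/
lemma IsShortestPathIn.exists_subpath {A X : Set V} {r : ℝ} {p : PathIn G}
    (hp : IsShortestPathIn G ℓ A p) (hX : ∀ x ∈ X, ∀ y ∈ X, DistLE G ℓ A x y r) :
    ∃ Q : List (PathIn G), Q.length ≤ 1 ∧ (∀ q ∈ Q, wlen ℓ q.walk ≤ r) ∧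
      ∀ z ∈ X, z ∈ p.walk.support → z ∈ pathSupp Q := by
  by_cases h : ∃ z ∈ X, z ∈ p.walk.support
  · obtain ⟨x, hx, y, hy, a, b, c, habc, hb⟩ := exists_append_first_last_mem X p.walk h
    have hpath := p.isPath
    rw [habc] at hpath
    refine ⟨[⟨x, y, b, hpath.of_append_right.of_append_left⟩], by simp, ?_, fun z hz hz' => ?_⟩
    · obtain ⟨q, hqA, hq⟩ := hX x hx y hy
      have hpA := hp.1
      rw [habc, walkIn_append, walkIn_append] at hpA
      have := hp.2 (a.append (q.append c))
        (walkIn_append.2 ⟨hpA.1, walkIn_append.2 ⟨hqA, hpA.2.2⟩⟩)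
      rw [habc] at this
      simp only [wlen_append] at this
      simp only [List.mem_singleton, forall_eq]
      linarith
    · exact ⟨_, List.mem_singleton_self _, hb z hz hz'⟩
  · refine ⟨[], by simp, by simp, fun z hz hz' => absurd ⟨z, hz, hz'⟩ h⟩

lemma pathSupp_append (P Q : List (PathIn G)) :
    pathSupp (P ++ Q) = pathSupp P ∪ pathSupp Q := by
  ext x
  simp only [pathSupp, List.mem_append, Set.mem_ofPred_eq, Set.mem_union]
  grind

lemma suppL_append_singleton (L : List (List (PathIn G))) (ps : List (PathIn G)) :
    suppL (L ++ [ps]) = suppL L ∪ pathSupp ps := by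
  ext x
  simp only [suppL, pathSupp, List.mem_append, Set.mem_ofPred_eq, Set.mem_union,
    List.mem_singleton]
  grind

lemma exists_subpaths {A X : Set V} {r : ℝ} (ps : List (PathIn G))
    (hps : ∀ p ∈ ps, IsShortestPathIn G ℓ A p)
    (hX : ∀ x ∈ X, ∀ y ∈ X, DistLE G ℓ A x y r) :
    ∃ Q : List (PathIn G), Q.length ≤ ps.length ∧ (∀ q ∈ Q, wlen ℓ q.walk ≤ r) ∧
      ∀ z ∈ X, z ∈ pathSupp ps → z ∈ pathSupp Q := by
  induction ps with
  | nil => exact ⟨[], le_rfl, by simp, fun _ _ h => h⟩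
  | cons p ps ih =>
    obtain ⟨Q, hQ, hQr, hQX⟩ := ih fun q hq => hps q (List.mem_cons_of_mem _ hq)
    obtain ⟨R, hR, hRr, hRX⟩ := (hps p List.mem_cons_self).exists_subpath hX
    refine ⟨R ++ Q, by simp; omega, fun q hq => ?_, fun z hz ⟨q, hq, hzq⟩ => ?_⟩
    · exact (List.mem_append.1 hq).elim (hRr q) (hQr q)
    · rw [pathSupp_append]
      rcases List.mem_cons.1 hq with rfl | hq
      · exact .inl (hRX z hz hzq)
      · exact .inr (hQX z hz ⟨q, hq, hzq⟩)

/-- The ball of radius `D` around `v` within `Z` has more than half of all the vertices. -/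
def IsHeavy [Fintype V] (G : SimpleGraph V) (ℓ : Sym2 V → ℝ) (D : ℝ) (Z : Set V) (v : V) : Prop :=
  Fintype.card V < 2 * Set.ncard {u : V | DistLE G ℓ Z v u D}

variable [Fintype V] {D : ℝ}

lemma IsHeavy.mono {Y Z : Set V} (h : Y ⊆ Z) {v : V} (hv : IsHeavy G ℓ D Y v) :
    IsHeavy G ℓ D Z v := by
  refine lt_of_lt_of_le hv (Nat.mul_le_mul_left 2 (Set.ncard_le_ncard ?_ (Set.toFinite _)))
  exact fun u hu => DistLE.mono h hu

lemma IsHeavy.exists_common {Z : Set V} {v w : V} (hv : IsHeavy G ℓ D Z v)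
    (hw : IsHeavy G ℓ D Z w) : ∃ u, DistLE G ℓ Z v u D ∧ DistLE G ℓ Z w u D := by
  by_contra! h
  have hd : Disjoint {u : V | DistLE G ℓ Z v u D} {u : V | DistLE G ℓ Z w u D} :=
    Set.disjoint_left.2 h
  have h1 := Set.ncard_union_eq hd (Set.toFinite _) (Set.toFinite _)
  have h2 := Set.ncard_le_card
    ({u : V | DistLE G ℓ Z v u D} ∪ {u : V | DistLE G ℓ Z w u D})
  rw [Nat.card_eq_fintype_card] at h2
  unfold IsHeavy at hv hw
  omega

/-- Groups of successively shortest paths can be trimmed to subpaths of length at most `4 * D`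
whose removal makes every remaining heavy ball disjoint from the original paths. -/
lemma exists_trimmed_paths (hℓ : PosWeights G ℓ) (L : List (List (PathIn G)))
    (hL : ∀ i : Fin L.length, ∀ p ∈ L.get i,
      IsShortestPathIn G ℓ (Set.univ \ suppL (L.take i)) p) (i : ℕ) (hi : i ≤ L.length) :
    ∃ Q : List (PathIn G), Q.length ≤ ((L.take i).map List.length).sum ∧
      (∀ q ∈ Q, wlen ℓ q.walk ≤ 4 * D) ∧
      ∀ v, IsHeavy G ℓ D (Set.univ \ pathSupp Q) v → ∀ u,
        DistLE G ℓ (Set.univ \ pathSupp Q) v u D → DistLE G ℓ (Set.univ \ suppL (L.take i)) v u D := by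
  induction i with
  | zero =>
    refine ⟨[], by simp, by simp, fun v _ u hu => hu.mono fun x _ => ?_⟩
    simp [suppL]
  | succ i ih =>
    obtain ⟨Q, hQ, hQD, hQL⟩ := ih (by omega)
    have htake : L.take (i + 1) = L.take i ++ [L[i]] := by simp
    set Z := Set.univ \ pathSupp Q with hZ
    obtain ⟨R, hR, hRD, hRX⟩ := exists_subpaths (r := 4 * D)
      (X := {x | ∃ v, IsHeavy G ℓ D Z v ∧ DistLE G ℓ Z v x D}) L[i] (hL ⟨i, by omega⟩) (by
        rintro x ⟨v, hv, hvx⟩ y ⟨w, hw, hwy⟩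
        obtain ⟨u, hvu, hwu⟩ := hv.exists_common hw
        convert (((hQL v hv x hvx).symm.trans (hQL v hv u hvu)).trans
          (hQL w hw u hwu).symm).trans (hQL w hw y hwy) using 1
        ring)
    have hsub : Set.univ \ pathSupp (Q ++ R) ⊆ Z := by
      rw [pathSupp_append]
      exact Set.sdiff_subset_sdiff_right Set.subset_union_left
    refine ⟨Q ++ R, ?_, fun q hq => (List.mem_append.1 hq).elim (hQD q) (hRD q), ?_⟩
    · rw [htake]
      simp only [List.map_append, List.sum_append, List.length_append, List.map_cons,
        List.map_nil, List.sum_cons, List.sum_nil]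
      omega
    · rintro v hv u ⟨q, hqZ, hqD⟩
      have hv' := hv.mono hsub
      refine ⟨q, fun x hx => ⟨Set.mem_univ x, ?_⟩, hqD⟩
      have hvx := distLE_of_mem_support hℓ q (hqZ.mono hsub) hqD hx
      rw [htake, suppL_append_singleton]
      rintro (hxL | hxL)
      · obtain ⟨q', hq', -⟩ := hQL v hv' x hvx
        exact (hq' x q'.end_mem_support).2 hxL
      · have := hRX x ⟨v, hv', hvx⟩ hxL
        apply (hqZ x hx).2
        rw [pathSupp_append]
        exact .inr this

end WeakSeparator

/-- **Weak separators for k-path separable graphs (existence form).** There is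
a universal constant `C > 0` with the following property. Let `G = (V,E,ℓ)` be
a weighted `k`-path separable graph with `n ≥ 2` vertices whose weighted
diameter is at most `D`, and let `ε ∈ (0,1]`. Then there exist
`κ ≤ C·ε⁻¹·k·log n` simple paths `P₁, …, P_κ` in `G`, each of total length at
most `4D`, together with vertex sets `B₁, …, B_κ` where each
`B_i ⊆ B_G(P_i, ε·D)`, such that every vertex `v` of `G` not belonging to any
`P_i` or `B_i` satisfies `|B_{G∖S}(v, D)| ≤ (7/8)·n`, where `S` is the union of
all vertices of the paths `P_i` and the sets `B_i`. -/
theorem weak_separator_exists :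
    ∃ C : ℝ, 0 < C ∧
      ∀ (V : Type) [Fintype V] [DecidableEq V],
      ∀ (G : SimpleGraph V) (ℓ : Sym2 V → ℝ) (k : ℕ) (D ε : ℝ),
        PosWeights G ℓ →
        2 ≤ Fintype.card V →
        KPathSep G ℓ k Set.univ →
        (∀ u v : V, DistLE G ℓ Set.univ u v D) →
        0 < ε → ε ≤ 1 →
        ∃ L : List (PathIn G × Set V),
          (L.length : ℝ) ≤ C * ε⁻¹ * (k : ℝ) * Real.log (Fintype.card V) ∧
          (∀ pb ∈ L, wlen ℓ pb.1.walk ≤ 4 * D) ∧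
          (∀ pb ∈ L, ∀ x ∈ pb.2,
            ∃ y ∈ pb.1.walk.support, DistLE G ℓ Set.univ y x (ε * D)) ∧
          (∀ S : Set V,
            S = {x | ∃ pb ∈ L, x ∈ pb.1.walk.support ∨ x ∈ pb.2} →
            ∀ v : V, v ∉ S →
              (Set.ncard {u : V | DistLE G ℓ (Set.univ \ S) v u D} : ℝ) ≤
                7 / 8 * (Fintype.card V : ℝ)) := by
  refine ⟨(Real.log 2)⁻¹, inv_pos.2 (Real.log_pos one_lt_two), ?_⟩
  intro V _ _ G ℓ k D ε hℓ hn hsep hdiam hε hε1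
  obtain ⟨-, L, hLk, hL, hcomp, -⟩ := hsep
  obtain ⟨Q, hQ, hQD, hQL⟩ := exists_trimmed_paths (D := D) hℓ L hL L.length le_rfl
  rw [List.take_length] at hQ hQL
  refine ⟨Q.map fun p => (p, ∅), ?_, ?_, ?_, ?_⟩
  · have hk : (Q.length : ℝ) ≤ k := by exact_mod_cast hQ.trans hLk
    have hlog2 : 0 < Real.log 2 := Real.log_pos one_lt_two
    have hlog : Real.log 2 ≤ Real.log (Fintype.card V) :=
      Real.log_le_log two_pos (by exact_mod_cast hn)
    have h1 : 1 ≤ (Real.log 2)⁻¹ * Real.log (Fintype.card V) := by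
      rw [inv_mul_eq_div]
      exact (one_le_div hlog2).2 hlog
    have h2 : 1 ≤ ε⁻¹ := (one_le_inv₀ hε).2 hε1
    have h3 := one_le_mul_of_one_le_of_one_le h1 h2
    rw [List.length_map]
    calc (Q.length : ℝ) ≤ 1 * k := by simpa using hk
      _ ≤ ((Real.log 2)⁻¹ * Real.log (Fintype.card V) * ε⁻¹) * k := by gcongr
      _ = _ := by ring
  · simpa using hQD
  · simp
  · intro S hS v hv
    have hSQ : S = pathSupp Q := by
      rw [hS]
      ext x
      simp [pathSupp]
    rw [hSQ] at hv ⊢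
    have key : ¬ IsHeavy G ℓ D (Set.univ \ pathSupp Q) v := by
      intro hheavy
      have hD : 0 ≤ D := by
        obtain ⟨p, -, hp⟩ := hdiam v v
        exact (wlen_nonneg hℓ p).trans hp
      obtain ⟨q, hq, -⟩ := hQL v hheavy v
        ⟨.nil, fun x hx => by
          obtain rfl : x = v := by simpa using hx
          exact ⟨Set.mem_univ x, hv⟩, by simpa [wlen] using hD⟩
      have hc := hcomp v (hq v q.start_mem_support)
      rw [Set.ncard_univ, Nat.card_eq_fintype_card] at hc
      refine absurd hheavy (not_lt.2 (le_trans (Nat.mul_le_mul_left 2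
        (Set.ncard_le_ncard ?_ (Set.toFinite _))) hc))
      intro u hu
      obtain ⟨q, hq, -⟩ := hQL v hheavy u hu
      exact ⟨hq u q.end_mem_support, q, hq⟩
    have key' := (Nat.cast_le (α := ℝ)).2 (not_lt.1 key)
    push_cast at key'
    have : (0 : ℝ) ≤ Fintype.card V := Nat.cast_nonneg _
    linarith
end
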